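/- The pseudovariety DO ∩ Ab̄ is κ-reducible for idempotent pointlike sets: let S be a finite semigroup and P a (DO ∩ Ab̄)-idempotent pointlike subset of S. Then for every finite alphabet A and every surjective homomorphism φ: A⁺ → S from the free semigroup on A, there exists a family (w_p)_{p∈P} of κ-terms over A such that, for each p ∈ P, w_p evaluates to p in S under the letter assignment given by φ restricted to A, and for every finite semigroup T in DO ∩ Ab̄ and every map from A to T, all the terms w_p evaluate to one and the same idempotent element of T. -/

import Mathlib

/-- `spow s n` is the power `s^(n+1)` of `s`, defined in any magma. -/
def spow {S : Type*} [Mul S] (s : S) (n : ℕ) : S := (fun x => x * s)^[n] s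

/-- The two-sided ideal of a semigroup `T` generated by the element `s`. -/
def idealGen {T : Type} [Semigroup T] (s : T) : Set T :=
  {x | x = s ∨ (∃ u, x = s * u) ∨ (∃ u, x = u * s) ∨ ∃ u v, x = u * s * v}

/-- The `J`-class of `s`: the set of elements generating the same two-sided
ideal as `s`. -/
def jClass {T : Type} [Semigroup T] (s : T) : Set T :=
  {x | idealGen x = idealGen s}

/-- A rectangular band is a semigroup satisfying `x * y * x = x`. -/
def IsRectangularBand (B : Type) [Semigroup B] : Prop :=
  ∀ x y : B, x * y * x = x

/-- The subset `J` of `T`, which is assumed closed under multiplication, is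
isomorphic as a semigroup (with the induced multiplication) to `B × G`. -/
def IsIsoToProd {T : Type} [Semigroup T] (J : Set T)
    (B G : Type) [Semigroup B] [CommGroup G] : Prop :=
  ∃ φ : ↥J → B × G, Function.Bijective φ ∧
    ∀ (x y : T) (hx : x ∈ J) (hy : y ∈ J) (hxy : x * y ∈ J),
      φ ⟨x * y, hxy⟩ = φ ⟨x, hx⟩ * φ ⟨y, hy⟩

/-- A finite semigroup `T` lies in `DO ∩ Ab̄` if every regular `J`-class of `T`
(i.e. one containing an idempotent) is closed under multiplication and, with
the induced multiplication, is isomorphic to the direct product of a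
rectangular band and an abelian group. -/
def InDOAb (T : Type) [Semigroup T] : Prop :=
  ∀ s : T, (∃ e ∈ jClass s, IsIdempotentElem e) →
    (∀ x ∈ jClass s, ∀ y ∈ jClass s, x * y ∈ jClass s) ∧
    ∃ (B G : Type) (iB : Semigroup B) (iG : CommGroup G),
      @IsRectangularBand B iB ∧ @IsIsoToProd T _ (jClass s) B G iB iG

/-- κ-terms over the alphabet `A`: letters, binary multiplication and the
unary `(ω-1)`-power. -/
inductive KTerm (A : Type) : Type
  | letter : A → KTerm A
  | mul : KTerm A → KTerm A → KTerm A
  | ommPow : KTerm A → KTerm A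

/-- The evaluation relation for κ-terms in a semigroup `T`, given an assignment
`f` of letters.  The `(ω-1)`-power of an element `s` is the element `g` of the
cyclic subsemigroup generated by `s` such that `g * s = s * g = e` and
`g * e = g`, where `e` is the (unique, in a finite semigroup) idempotent power
`s^ω` of `s`. -/
inductive KEval {A T : Type} [Semigroup T] (f : A → T) : KTerm A → T → Prop
  | letter (a : A) : KEval f (KTerm.letter a) (f a)
  | mul {u v : KTerm A} {s t : T} :
      KEval f u s → KEval f v t → KEval f (KTerm.mul u v) (s * t)
  | ommPow {u : KTerm A} {s e g : T} :
      KEval f u s →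
      IsIdempotentElem e → (∃ n : ℕ, spow s n = e) →
      (∃ n : ℕ, spow s n = g) →
      g * s = e → s * g = e → g * e = g →
      KEval f (KTerm.ommPow u) g

/-- `P` is idempotent pointlike for the pseudovariety `DO ∩ Ab̄`: for every finite
semigroup `T` in `DO ∩ Ab̄` and every subsemigroup `R` of `S × T` projecting onto
`S`, some idempotent `t ∈ T` is related to every element of `P`. -/
def IsDOAbIdempotentPointlike {S : Type} [Semigroup S] (P : Set S) : Prop :=
  ∀ (T : Type) [Semigroup T] [Finite T], InDOAb T →
    ∀ R : Subsemigroup (S × T),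
      (∀ s : S, ∃ t : T, (s, t) ∈ R) →
      ∃ t : T, IsIdempotentElem t ∧ ∀ p ∈ P, (p, t) ∈ R



inductive MTerm (A : Type) : Type
  | one : MTerm A
  | letter : A → MTerm A
  | mul : MTerm A → MTerm A → MTerm A
  | pow : MTerm A → MTerm A

namespace MTerm
variable {A : Type}

def eval {M : Type} [Monoid M] (K : ℕ) (f : A → M) : MTerm A → M
  | one => 1
  | letter a => f a
  | mul u v => eval K f u * eval K f v
  | pow u => (eval K f u) ^ (2 * K - 1)

def cont : MTerm A → Set A
  | one => ∅
  | letter a => {a}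
  | mul u v => cont u ∪ cont v
  | pow u => cont u

open Classical in
noncomputable def cnt : MTerm A → (A → ℤ)
  | one => 0
  | letter a => Pi.single a 1
  | mul u v => cnt u + cnt v
  | pow u => - cnt u

/-- the omega power -/
def om (x : MTerm A) : MTerm A := mul (pow x) x

end MTerm

structure GoodExp (K : ℕ) (M : Type) [Monoid M] : Prop where
  pos : 0 < K
  idem : ∀ x : M, IsIdempotentElem (x ^ K)

theorem exists_goodExp (M : Type) [Monoid M] [Finite M] : ∃ K, GoodExp K M := by
  have h : ∀ x : M, ∃ n : ℕ, 0 < n ∧ IsIdempotentElem (x ^ n) := by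
    intro x
    obtain ⟨i, j, hij, h⟩ : ∃ i j : ℕ, i < j ∧ x ^ i = x ^ j := by
      obtain ⟨i, j, hne, h⟩ := Finite.exists_ne_map_eq_of_infinite (fun n : ℕ => x ^ n)
      rcases lt_or_gt_of_ne hne with h1 | h1
      · exact ⟨i, j, h1, h⟩
      · exact ⟨j, i, h1, h.symm⟩
    obtain ⟨d, rfl⟩ := Nat.exists_eq_add_of_lt hij
    have h1 : ∀ t k, x ^ (i + t) = x ^ (i + t + k * (d + 1)) := by
      intro t k
      induction k with
      | zero => simp
      | succ k ih =>
        rw [ih]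
        have : i + t + k * (d + 1) = i + (t + k * (d+1)) := by ring
        rw [this, pow_add, h, ← pow_add]; congr 1; ring
    refine ⟨(i + 1) * (d + 1), by positivity, ?_⟩
    unfold IsIdempotentElem
    rw [← pow_add]
    have h2 := h1 ((i+1)*(d+1) - i) (i+1)
    have h3 : i + ((i+1)*(d+1) - i) = (i+1)*(d+1) := by
      apply Nat.add_sub_cancel'; nlinarith
    rw [h3] at h2
    exact h2.symm
  choose n hn hi using h
  cases nonempty_fintype M
  refine ⟨∏ x, n x, Finset.prod_pos fun x _ => hn x, fun x => ?_⟩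
  obtain ⟨k, hk⟩ : n x ∣ ∏ x, n x := Finset.dvd_prod_of_mem _ (Finset.mem_univ x)
  rw [hk, pow_mul]
  have hk0 : k ≠ 0 := by
    rintro rfl
    have : 0 < ∏ x, n x := Finset.prod_pos fun x _ => hn x
    omega
  rw [(hi x).pow_eq hk0]
  exact hi x

theorem GoodExp.two_mul {K : ℕ} {M : Type} [Monoid M] (h : GoodExp K M) (x : M) :
    x ^ (2 * K - 1) * x = x ^ K := by
  have := h.pos
  rw [← pow_succ, show 2 * K - 1 + 1 = K + K by omega, pow_add]; exact h.idem x

theorem MTerm.eval_om {A M : Type} [Monoid M] {K : ℕ} (h : GoodExp K M) (f : A → M)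
    (x : MTerm A) : (om x).eval K f = (x.eval K f) ^ K := h.two_mul _

theorem MTerm.cnt_om {A : Type} (x : MTerm A) : (om x).cnt = 0 := by
  simp [om, cnt]

theorem MTerm.cont_om {A : Type} (x : MTerm A) : (om x).cont = x.cont := by
  simp [om, cont]

theorem withOne_cases {T : Type} (x : WithOne T) : x = 1 ∨ ∃ y : T, x = y := by
  by_cases h : x = 1
  · exact Or.inl h
  · obtain ⟨y, hy⟩ := WithOne.ne_one_iff_exists.1 h
    exact Or.inr ⟨y, hy.symm⟩

theorem mem_idealGen_iff {T : Type} [Semigroup T] (x y : T) :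
    y ∈ idealGen x ↔ ∃ p q : WithOne T, (y : WithOne T) = p * x * q := by
  constructor
  · rintro (h | ⟨u, h⟩ | ⟨u, h⟩ | ⟨u, v, h⟩)
    · exact ⟨1, 1, by simp [h]⟩
    · exact ⟨1, u, by simp [h]⟩
    · exact ⟨u, 1, by simp [h]⟩
    · exact ⟨u, v, by simp [h]⟩
  · rintro ⟨p, q, h⟩
    rcases withOne_cases p with rfl | ⟨p, rfl⟩ <;> rcases withOne_cases q with rfl | ⟨q, rfl⟩
    · left; simpa using h
    · right; left; refine ⟨q, ?_⟩; rw [one_mul] at h; exact_mod_cast h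
    · right; right; left; refine ⟨p, ?_⟩; rw [mul_one] at h; exact_mod_cast h
    · right; right; right; refine ⟨p, q, ?_⟩; exact_mod_cast h

def JR {M : Type} [Monoid M] (e x : M) : Prop :=
  (∃ p q, x = p * e * q) ∧ ∃ p q, e = p * x * q

theorem mem_jClass_iff {T : Type} [Semigroup T] (x e : T) :
    x ∈ jClass e ↔ JR (e : WithOne T) x := by
  unfold jClass JR
  rw [← mem_idealGen_iff, ← mem_idealGen_iff, Set.mem_ofPred_eq]
  constructor
  · intro h
    refine ⟨h ▸ ?_, h ▸ ?_⟩ <;> exact Or.inl rfl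
  · rintro ⟨h1, h2⟩
    rw [mem_idealGen_iff] at h1 h2
    obtain ⟨p, q, h1⟩ := h1
    obtain ⟨p', q', h2⟩ := h2
    ext y
    rw [mem_idealGen_iff, mem_idealGen_iff]
    constructor
    · rintro ⟨r, s, h⟩; exact ⟨r * p, q * s, by rw [h, h1]; simp only [mul_assoc]⟩
    · rintro ⟨r, s, h⟩; exact ⟨r * p', q' * s, by rw [h, h2]; simp only [mul_assoc]⟩

structure JData (M : Type) [Monoid M] (e : M) (B G : Type) [Semigroup B] [CommGroup G]
    (β : M → B) (γ : M → G) : Prop where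
  rect : ∀ x y : B, x * y * x = x
  closed : ∀ x y, JR e x → JR e y → JR e (x * y)
  mapβ : ∀ x y, JR e x → JR e y → β (x * y) = β x * β y
  mapγ : ∀ x y, JR e x → JR e y → γ (x * y) = γ x * γ y
  inj : ∀ x y, JR e x → JR e y → β x = β y → γ x = γ y → x = y

theorem doab_data {T : Type} [Semigroup T] (hT : InDOAb T) (e : T) (he : IsIdempotentElem e) :
    ∃ (B G : Type) (_ : Semigroup B) (_ : CommGroup G) (β : WithOne T → B) (γ : WithOne T → G),
      JData (WithOne T) e B G β γ := by
  obtain ⟨hcl, B, G, iB, iG, hrect, ψ, hbij, hmul⟩ := hT e ⟨e, rfl, he⟩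
  classical
  let ψ' : WithOne T → B × G := fun x =>
    if h : ∃ y : T, y ∈ jClass e ∧ (y : WithOne T) = x then ψ ⟨h.choose, h.choose_spec.1⟩
    else ψ ⟨e, rfl⟩
  have hψ : ∀ (y : T) (hy : y ∈ jClass e), ψ' y = ψ ⟨y, hy⟩ := by
    intro y hy
    have h : ∃ z : T, z ∈ jClass e ∧ (z : WithOne T) = y := ⟨y, hy, rfl⟩
    simp only [ψ', dif_pos h]
    congr 2
    exact WithOne.coe_injective h.choose_spec.2
  have hcoe : ∀ x : WithOne T, JR (e : WithOne T) x → ∃ y : T, y ∈ jClass e ∧ x = y := by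
    intro x hx
    rcases withOne_cases x with rfl | ⟨y, rfl⟩
    · obtain ⟨⟨p, q, h⟩, -⟩ := hx
      exfalso
      rcases withOne_cases p with rfl | ⟨p, rfl⟩ <;> rcases withOne_cases q with rfl | ⟨q, rfl⟩ <;>
        (try simp only [one_mul, mul_one] at h) <;> revert h <;> (try simp only [← WithOne.coe_mul]) <;>
        exact fun h => WithOne.one_ne_coe h
    · exact ⟨y, (mem_jClass_iff y e).2 hx, rfl⟩
  refine ⟨B, G, iB, iG, fun x => (ψ' x).1, fun x => (ψ' x).2, hrect, ?_, ?_, ?_, ?_⟩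
  · intro x y hx hy
    obtain ⟨x, hx', rfl⟩ := hcoe x hx
    obtain ⟨y, hy', rfl⟩ := hcoe y hy
    exact (mem_jClass_iff _ _).1 (hcl x hx' y hy')
  · intro x y hx hy
    obtain ⟨x, hx', rfl⟩ := hcoe x hx
    obtain ⟨y, hy', rfl⟩ := hcoe y hy
    rw [← WithOne.coe_mul, hψ _ (hcl x hx' y hy'), hψ _ hx', hψ _ hy', hmul x y hx' hy']; rfl
  · intro x y hx hy
    obtain ⟨x, hx', rfl⟩ := hcoe x hx
    obtain ⟨y, hy', rfl⟩ := hcoe y hy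
    rw [← WithOne.coe_mul, hψ _ (hcl x hx' y hy'), hψ _ hx', hψ _ hy', hmul x y hx' hy']; rfl
  · intro x y hx hy h1 h2
    obtain ⟨x, hx', rfl⟩ := hcoe x hx
    obtain ⟨y, hy', rfl⟩ := hcoe y hy
    simp only [hψ _ hx', hψ _ hy'] at h1 h2
    have := hbij.1 (Prod.ext h1 h2)
    simpa using this

section
variable {M : Type} [Monoid M] {e : M} {B G : Type} [Semigroup B] [CommGroup G]
  {β : M → B} {γ : M → G}

theorem JR.self (e : M) : JR e e := ⟨⟨1, 1, by simp⟩, ⟨1, 1, by simp⟩⟩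

theorem JR.letter (hd : JData M e B G β γ) (he : e * e = e) {a p q : M} (ha : e = p * a * q)
    {j : M} (hj : JR e j) : JR e (j * a) ∧ JR e (a * j) := by
  have hj' := hj
  obtain ⟨⟨r, s, h1⟩, ⟨r', s', h2⟩⟩ := hj'
  have hf : JR e (a * q * e * p) := by
    refine ⟨⟨a * q, p, by simp only [mul_assoc]⟩, ⟨p, a * q, ?_⟩⟩
    calc e = e * e * e := by rw [he, he]
      _ = (p * a * q) * e * (p * a * q) := by rw [← ha]
      _ = _ := by simp only [mul_assoc]
  have hg : JR e (q * e * p * a) := by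
    refine ⟨⟨q, p * a, by simp only [mul_assoc]⟩, ⟨p * a, q, ?_⟩⟩
    calc e = e * e * e := by rw [he, he]
      _ = (p * a * q) * e * (p * a * q) := by rw [← ha]
      _ = _ := by simp only [mul_assoc]
  constructor
  · refine ⟨⟨r, s * a, by rw [h1]; simp only [mul_assoc]⟩, ?_⟩
    obtain ⟨-, ⟨x, y, h⟩⟩ := hd.closed _ _ hj hf
    exact ⟨x, q * e * p * y, h.trans (by simp only [mul_assoc])⟩
  · refine ⟨⟨a * r, s, by rw [h1]; simp only [mul_assoc]⟩, ?_⟩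
    obtain ⟨-, ⟨x, y, h⟩⟩ := hd.closed _ _ hg hj
    exact ⟨x * (q * e * p), y, h.trans (by simp only [mul_assoc])⟩

/-- `t` acts on the `J`-class of `e`. -/
def JAct (e t : M) : Prop := ∀ j, JR e j → JR e (j * t) ∧ JR e (t * j)

theorem JAct.one : JAct e 1 := fun j hj => by simpa using hj

theorem JAct.mul {s t : M} (hs : JAct e s) (ht : JAct e t) : JAct e (s * t) := by
  intro j hj
  constructor
  · rw [← mul_assoc]; exact (ht _ (hs j hj).1).1
  · rw [mul_assoc]; exact (hs _ (ht j hj).2).2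

theorem JAct.pow {s : M} (hs : JAct e s) (n : ℕ) : JAct e (s ^ n) := by
  induction n with
  | zero => rw [pow_zero]; exact JAct.one
  | succ n ih => rw [pow_succ]; exact ih.mul hs

theorem JAct.eval {A : Type} (K : ℕ) (f : A → M) (m : MTerm A)
    (h : ∀ a ∈ m.cont, JAct e (f a)) : JAct e (m.eval K f) := by
  induction m with
  | one => exact JAct.one
  | letter a => exact h a rfl
  | mul u v hu hv => exact (hu fun a ha => h a (Or.inl ha)).mul (hv fun a ha => h a (Or.inr ha))
  | pow u hu => exact (hu h).pow _

theorem γ_idem (hd : JData M e B G β γ) {f : M} (hf : f * f = f) (hj : JR e f) : γ f = 1 := by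
  have := hd.mapγ f f hj hj
  rw [hf] at this
  exact (mul_eq_left.1 this.symm)

theorem γ_mul (hd : JData M e B G β γ) (he : e * e = e) {s t : M} (hs : JAct e s)
    (ht : JAct e t) : γ (e * (s * t)) = γ (e * s) * γ (e * t) := by
  have hJ := JR.self e
  have h1 := hd.mapγ _ _ (hs e hJ).1 (ht e hJ).2
  have h2 := hd.mapγ _ _ ((hs.mul ht) e hJ).1 hJ
  have h3 := hd.mapγ _ _ ((ht) e hJ).1 hJ
  have h4 := hd.mapγ _ _ hJ ((ht) e hJ).2
  have he1 := γ_idem hd he hJ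
  rw [he1] at h2 h3 h4
  rw [mul_one] at h2 h3
  rw [one_mul] at h4
  rw [← h2, ← h3]
  rw [show e * (s * t) * e = e * s * (t * e) by simp only [mul_assoc], h1, ← h4]
  simp only [mul_assoc]

theorem γ_pow (hd : JData M e B G β γ) (he : e * e = e) {s : M} (hs : JAct e s) (n : ℕ) :
    γ (e * s ^ n) = γ (e * s) ^ n := by
  induction n with
  | zero => simp [γ_idem hd he (JR.self e)]
  | succ n ih => rw [pow_succ, γ_mul hd he (hs.pow n) hs, ih, pow_succ]

theorem γ_eval {A : Type} [Fintype A] {K : ℕ} (hK : GoodExp K M) (f : A → M)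
    (hd : JData M e B G β γ) (he : e * e = e) (m : MTerm A)
    (h : ∀ a ∈ m.cont, JAct e (f a)) :
    γ (e * m.eval K f) = ∏ a, γ (e * f a) ^ (m.cnt a) := by
  classical
  induction m with
  | one => simp [MTerm.eval, MTerm.cnt, γ_idem hd he (JR.self e)]
  | letter a =>
    simp only [MTerm.eval, MTerm.cnt]
    rw [Finset.prod_eq_single a]
    · simp
    · intro b _ hb; simp [hb]
    · simp
  | mul u v hu hv =>
    have h1 : ∀ a ∈ u.cont, JAct e (f a) := fun a ha => h a (Or.inl ha)
    have h2 : ∀ a ∈ v.cont, JAct e (f a) := fun a ha => h a (Or.inr ha)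
    simp only [MTerm.eval, MTerm.cnt, Pi.add_apply, zpow_add, Finset.prod_mul_distrib]
    rw [γ_mul hd he (JAct.eval K f u h1) (JAct.eval K f v h2), hu h1, hv h2]
  | pow u hu =>
    have h1 : ∀ a ∈ u.cont, JAct e (f a) := h
    have h2 := JAct.eval K f u h1
    simp only [MTerm.eval, MTerm.cnt, Pi.neg_apply, zpow_neg, Finset.prod_inv_distrib]
    rw [← hu h1, γ_pow hd he h2]
    have h3 : γ (e * u.eval K f) ^ K = 1 := by
      have h4 := γ_pow hd he h2 (K + K)
      rw [pow_add, hK.idem _, γ_pow hd he h2, pow_add] at h4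
      exact (mul_eq_left.1 h4.symm)
    rw [eq_inv_iff_mul_eq_one, ← pow_succ, show 2 * K - 1 + 1 = K + K by have := hK.pos; omega,
      pow_add, h3, one_mul]

theorem eval_factor {A : Type} {K : ℕ} (hK : 0 < K) (f : A → M) (m : MTerm A) {a : A}
    (ha : a ∈ m.cont) : ∃ p q, m.eval K f = p * f a * q := by
  have aux : ∀ (x : M), (∃ p q, x = p * f a * q) → ∀ n, 0 < n → ∃ p q, x ^ n = p * f a * q := by
    rintro x ⟨p, q, h⟩ n hn
    obtain ⟨n, rfl⟩ := Nat.exists_eq_succ_of_ne_zero hn.ne'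
    refine ⟨x ^ n * p, q, ?_⟩
    rw [Nat.succ_eq_add_one, pow_succ]
    nth_rw 2 [h]
    simp only [mul_assoc]
  induction m with
  | one => exact absurd ha (by simp [MTerm.cont])
  | letter b =>
    obtain rfl : a = b := ha
    exact ⟨1, 1, by simp [MTerm.eval]⟩
  | mul u v hu hv =>
    rcases ha with ha | ha
    · obtain ⟨p, q, h⟩ := hu ha
      exact ⟨p, q * v.eval K f, by simp only [MTerm.eval, h, mul_assoc]⟩
    · obtain ⟨p, q, h⟩ := hv ha
      exact ⟨u.eval K f * p, q, by simp only [MTerm.eval, h, mul_assoc]⟩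
  | pow u hu => exact aux _ (hu ha) _ (by omega)

theorem eval_pow_factor {A : Type} {K : ℕ} (hK : 0 < K) (f : A → M) (m : MTerm A) {a : A}
    (ha : a ∈ m.cont) : ∃ p q, m.eval K f ^ K = p * f a * q := by
  obtain ⟨p, q, h⟩ := eval_factor hK f m ha
  obtain ⟨n, rfl⟩ := Nat.exists_eq_succ_of_ne_zero hK.ne'
  refine ⟨m.eval (n+1) f ^ n * p, q, ?_⟩
  rw [Nat.succ_eq_add_one, pow_succ]
  nth_rw 2 [h]
  simp only [mul_assoc]

theorem V1_aux {A : Type} [Finite A] {K : ℕ} (hK : GoodExp K M) (f : A → M)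
    (x y m m' : MTerm A) (hd : JData M (x.eval K f ^ K) B G β γ)
    (hy : JR (x.eval K f ^ K) (y.eval K f ^ K))
    (hm : m.cont ⊆ x.cont) (hm' : m'.cont ⊆ x.cont) (hc : m.cnt = m'.cnt) :
    x.eval K f ^ K * m.eval K f * y.eval K f ^ K =
      x.eval K f ^ K * m'.eval K f * y.eval K f ^ K := by
  cases nonempty_fintype A
  have he := hK.idem (x.eval K f)
  have hJ := JR.self (x.eval K f ^ K)
  have hact : ∀ a ∈ x.cont, JAct (x.eval K f ^ K) (f a) := by
    intro a ha j hj
    obtain ⟨p, q, h⟩ := eval_pow_factor hK.pos f x ha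
    exact JR.letter hd he h hj
  have h1 := JAct.eval K f m fun a ha => hact a (hm ha)
  have h2 := JAct.eval K f m' fun a ha => hact a (hm' ha)
  have hβ : ∀ t, JAct (x.eval K f ^ K) t →
      β (x.eval K f ^ K * t * y.eval K f ^ K) = β (x.eval K f ^ K) * β (y.eval K f ^ K) := by
    intro t ht
    have e1 : x.eval K f ^ K * t = x.eval K f ^ K * (x.eval K f ^ K * t) := by
      rw [← mul_assoc, he]
    rw [hd.mapβ _ _ (ht _ hJ).1 hy, e1, hd.mapβ _ _ hJ (ht _ hJ).1]
    generalize β (x.eval K f ^ K) = a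
    generalize β (y.eval K f ^ K) = b
    generalize β (x.eval K f ^ K * t) = c
    calc a * c * b = a * c * (b * a * b) := by rw [hd.rect]
      _ = (a * (c * b) * a) * b := by simp only [mul_assoc]
      _ = _ := by rw [hd.rect]
  refine hd.inj _ _ (hd.closed _ _ (h1 _ hJ).1 hy) (hd.closed _ _ (h2 _ hJ).1 hy) ?_ ?_
  · rw [hβ _ h1, hβ _ h2]
  · rw [hd.mapγ _ _ (h1 _ hJ).1 hy, hd.mapγ _ _ (h2 _ hJ).1 hy,
      γ_eval hK f hd he m fun a ha => hact a (hm ha),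
      γ_eval hK f hd he m' fun a ha => hact a (hm' ha), hc]

end

theorem eval_coe {A T : Type} [Semigroup T] {K : ℕ} (hK : 0 < K) (g : A → T) (m : MTerm A)
    (h : m.cont.Nonempty) : ∃ t : T, m.eval K (fun a => (g a : WithOne T)) = t := by
  obtain ⟨a, ha⟩ := h
  obtain ⟨p, q, h⟩ := eval_factor hK (fun a => (g a : WithOne T)) m ha
  rw [h]
  rcases withOne_cases p with rfl | ⟨p, rfl⟩ <;> rcases withOne_cases q with rfl | ⟨q, rfl⟩
  · exact ⟨g a, by simp⟩
  · exact ⟨g a * q, by simp⟩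
  · exact ⟨p * g a, by simp⟩
  · exact ⟨p * g a * q, by simp⟩

theorem coe_pow_exists {T : Type} [Semigroup T] (t : T) {K : ℕ} (hK : 0 < K) :
    ∃ s : T, (t : WithOne T) ^ K = s := by
  obtain ⟨n, rfl⟩ := Nat.exists_eq_succ_of_ne_zero hK.ne'
  induction n with
  | zero => exact ⟨t, by simp⟩
  | succ n ih =>
    obtain ⟨s, hs⟩ := ih (by omega)
    exact ⟨s * t, by rw [Nat.succ_eq_add_one, pow_succ, hs]; simp⟩

theorem V1 {A T : Type} [Finite A] [Semigroup T] (hT : InDOAb T) {K : ℕ}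
    (hK : GoodExp K (WithOne T)) (g : A → T)
    (x y m m' : MTerm A) (hx : x.cont.Nonempty) (hxy : x.cont = y.cont)
    (hm : m.cont ⊆ x.cont) (hm' : m'.cont ⊆ x.cont) (hc : m.cnt = m'.cnt) :
    (fun f => x.eval K f ^ K * m.eval K f * y.eval K f ^ K =
      x.eval K f ^ K * m'.eval K f * y.eval K f ^ K) (fun a => (g a : WithOne T)) := by
  have key : ∀ x y : MTerm A, x.cont.Nonempty → y.cont ⊆ x.cont →
      ∃ p q, x.eval K (fun a => (g a : WithOne T)) ^ K =
        p * y.eval K (fun a => (g a : WithOne T)) ^ K * q := by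
    intro x y hx hxy
    obtain ⟨t, ht⟩ := eval_coe hK.pos g x hx
    obtain ⟨s, hs⟩ := coe_pow_exists t hK.pos
    have he := hK.idem (x.eval K (fun a => (g a : WithOne T)))
    have hse : IsIdempotentElem s := by
      rw [ht, hs] at he
      unfold IsIdempotentElem at he ⊢
      exact_mod_cast he
    obtain ⟨B, G, iB, iG, β, γ, hd⟩ := doab_data hT s hse
    rw [← hs, ← ht] at hd
    have hact : JAct (x.eval K (fun a => (g a : WithOne T)) ^ K)
        (y.eval K (fun a => (g a : WithOne T)) ^ K) := by
      apply JAct.pow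
      apply JAct.eval
      intro a ha j hj
      obtain ⟨p, q, h⟩ := eval_pow_factor hK.pos (fun a => (g a : WithOne T)) x (hxy ha)
      exact JR.letter hd he h hj
    obtain ⟨-, p, q, h⟩ := (hact _ (JR.self _)).1
    exact ⟨p * _, q, by rw [mul_assoc p]; exact h⟩
  obtain ⟨t, ht⟩ := eval_coe hK.pos g x hx
  obtain ⟨s, hs⟩ := coe_pow_exists t hK.pos
  have he := hK.idem (x.eval K (fun a => (g a : WithOne T)))
  have hse : IsIdempotentElem s := by
    rw [ht, hs] at he
    unfold IsIdempotentElem at he ⊢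
    exact_mod_cast he
  obtain ⟨B, G, iB, iG, β, γ, hd⟩ := doab_data hT s hse
  rw [← hs, ← ht] at hd
  exact V1_aux hK _ x y m m' hd ⟨key y x (hxy ▸ hx) hxy.le, key x y hx hxy.ge⟩ hm hm' hc


section words
open Classical
variable {A : Type}

/-- prefix before the first `a` -/
noncomputable def preL (a : A) (u : List A) : List A := u.takeWhile (fun b => decide (b ≠ a))
/-- suffix after the first `a` -/
noncomputable def postL (a : A) (u : List A) : List A :=
  (u.dropWhile (fun b => decide (b ≠ a))).tail

theorem preL_append_of_mem {a : A} {u : List A} (h : a ∈ u) (v : List A) :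
    preL a (u ++ v) = preL a u := by
  unfold preL
  induction u with
  | nil => simp at h
  | cons b u ih =>
    by_cases hb : b = a
    · simp [hb]
    · have : a ∈ u := by simpa [Ne.symm hb] using h
      simp only [List.cons_append, List.takeWhile_cons, hb, ne_eq, not_false_eq_true, decide_true,
        if_true]
      rw [← ih this]

theorem postL_append_of_mem {a : A} {u : List A} (h : a ∈ u) (v : List A) :
    postL a (u ++ v) = postL a u ++ v := by
  unfold postL
  induction u with
  | nil => simp at h
  | cons b u ih =>
    by_cases hb : b = a
    · simp [hb]
    · have : a ∈ u := by simpa [Ne.symm hb] using h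
      simp only [List.cons_append, List.dropWhile_cons, hb, ne_eq, not_false_eq_true, decide_true,
        if_true]
      rw [← ih this]

theorem preL_append_of_not_mem {a : A} {u : List A} (h : a ∉ u) (v : List A) :
    preL a (u ++ v) = u ++ preL a v := by
  unfold preL
  induction u with
  | nil => rfl
  | cons b u ih =>
    have hb : b ≠ a := fun hb => h (by simp [hb])
    have : a ∉ u := fun hu => h (by simp [hu])
    have := ih this
    simp only [ne_eq, decide_not] at this
    simp [hb, this]

theorem postL_append_of_not_mem {a : A} {u : List A} (h : a ∉ u) (v : List A) :
    postL a (u ++ v) = postL a v := by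
  unfold postL
  induction u with
  | nil => rfl
  | cons b u ih =>
    have hb : b ≠ a := fun hb => h (by simp [hb])
    have : a ∉ u := fun hu => h (by simp [hu])
    have := ih this
    simp only [ne_eq, decide_not] at this
    simp [hb, this]

theorem preL_post {a : A} {u : List A} (h : a ∈ u) : u = preL a u ++ [a] ++ postL a u := by
  unfold preL postL
  induction u with
  | nil => simp at h
  | cons b u ih =>
    by_cases hb : b = a
    · simp [hb]
    · have : a ∈ u := by simpa [Ne.symm hb] using h
      have := ih this
      simp only [List.takeWhile_cons, List.dropWhile_cons, hb, ne_eq, not_false_eq_true,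
        decide_true, if_true, List.cons_append]
      rw [← this]

theorem not_mem_preL (a : A) (u : List A) : a ∉ preL a u := by
  unfold preL
  intro h
  simpa using List.mem_takeWhile_imp h

theorem preL_of_not_mem {a : A} {u : List A} (h : a ∉ u) : preL a u = u := by
  have := preL_append_of_not_mem h []
  simpa [preL] using this

theorem postL_of_not_mem {a : A} {u : List A} (h : a ∉ u) : postL a u = [] := by
  have := postL_append_of_not_mem h []
  simpa [postL] using this

def EE (n : ℕ) : ℕ → List A → List A → Prop
  | 0, u, v => (∀ a, a ∈ u ↔ a ∈ v) ∧ ∀ a, (u.count a : ZMod n) = (v.count a : ZMod n)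
  | k + 1, u, v => EE n k u v ∧ ∀ a, EE n k (preL a u) (preL a v) ∧
      EE n k (postL a u) (postL a v) ∧ EE n k (preL a u.reverse) (preL a v.reverse) ∧
      EE n k (postL a u.reverse) (postL a v.reverse)

variable {n : ℕ}

theorem EE.refl (k : ℕ) (u : List A) : EE n k u u := by
  induction k generalizing u with
  | zero => exact ⟨fun _ => Iff.rfl, fun _ => rfl⟩
  | succ k ih => exact ⟨ih _, fun a => ⟨ih _, ih _, ih _, ih _⟩⟩

theorem EE.symm {k : ℕ} {u v : List A} (h : EE n k u v) : EE n k v u := by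
  induction k generalizing u v with
  | zero => exact ⟨fun a => (h.1 a).symm, fun a => (h.2 a).symm⟩
  | succ k ih =>
    exact ⟨ih h.1, fun a => ⟨ih (h.2 a).1, ih (h.2 a).2.1, ih (h.2 a).2.2.1, ih (h.2 a).2.2.2⟩⟩

theorem EE.trans {k : ℕ} {u v w : List A} (h : EE n k u v) (h' : EE n k v w) : EE n k u w := by
  induction k generalizing u v w with
  | zero => exact ⟨fun a => (h.1 a).trans (h'.1 a), fun a => (h.2 a).trans (h'.2 a)⟩
  | succ k ih =>
    exact ⟨ih h.1 h'.1, fun a => ⟨ih (h.2 a).1 (h'.2 a).1, ih (h.2 a).2.1 (h'.2 a).2.1,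
      ih (h.2 a).2.2.1 (h'.2 a).2.2.1, ih (h.2 a).2.2.2 (h'.2 a).2.2.2⟩⟩

theorem EE.le {k l : ℕ} (hkl : k ≤ l) {u v : List A} (h : EE n l u v) : EE n k u v := by
  induction hkl with
  | refl => exact h
  | step _ ih => exact ih h.1

theorem EE.zero {k : ℕ} {u v : List A} (h : EE n k u v) : EE n 0 u v := h.le (Nat.zero_le _)

theorem EE.dvd {m : ℕ} (hmn : m ∣ n) {k : ℕ} {u v : List A} (h : EE n k u v) : EE m k u v := by
  induction k generalizing u v with
  | zero =>
    refine ⟨h.1, fun a => ?_⟩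
    have := h.2 a
    rw [ZMod.natCast_eq_natCast_iff] at this ⊢
    exact this.of_dvd hmn
  | succ k ih =>
    exact ⟨ih h.1, fun a => ⟨ih (h.2 a).1, ih (h.2 a).2.1, ih (h.2 a).2.2.1, ih (h.2 a).2.2.2⟩⟩

theorem EE.reverse {k : ℕ} {u v : List A} (h : EE n k u v) : EE n k u.reverse v.reverse := by
  induction k generalizing u v with
  | zero => exact ⟨fun a => by simpa using h.1 a, fun a => by simpa using h.2 a⟩
  | succ k ih =>
    refine ⟨ih h.1, fun a => ⟨(h.2 a).2.2.1, (h.2 a).2.2.2, ?_, ?_⟩⟩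
    · simpa using (h.2 a).1
    · simpa using (h.2 a).2.1

/-- both sided congruence -/
theorem EE.append {k : ℕ} {u v u' v' : List A} (h : EE n k u v) (h' : EE n k u' v') :
    EE n k (u ++ u') (v ++ v') := by
  induction k generalizing u v u' v' with
  | zero =>
    refine ⟨fun a => by simp [h.1 a, h'.1 a], fun a => ?_⟩
    simp only [List.count_append, Nat.cast_add, h.2 a, h'.2 a]
  | succ k ih =>
    refine ⟨ih h.1 h'.1, fun a => ?_⟩
    have hc := h.zero.1 a
    have hc' := h'.zero.1 a
    have h1 := h.1
    have h1' := h'.1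
    obtain ⟨a1, a2, a3, a4⟩ := h.2 a
    obtain ⟨b1, b2, b3, b4⟩ := h'.2 a
    refine ⟨?_, ?_, ?_, ?_⟩
    · by_cases hu : a ∈ u
      · rw [preL_append_of_mem hu, preL_append_of_mem (hc.1 hu)]; exact a1
      · rw [preL_append_of_not_mem hu, preL_append_of_not_mem (mt hc.2 hu)]; exact ih h1 b1
    · by_cases hu : a ∈ u
      · rw [postL_append_of_mem hu, postL_append_of_mem (hc.1 hu)]; exact ih a2 h1'
      · rw [postL_append_of_not_mem hu, postL_append_of_not_mem (mt hc.2 hu)]; exact b2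
    · rw [List.reverse_append, List.reverse_append]
      by_cases hu : a ∈ u'
      · rw [preL_append_of_mem (by simpa), preL_append_of_mem (by simpa using hc'.1 hu)]; exact b3
      · rw [preL_append_of_not_mem (by simpa), preL_append_of_not_mem (by simpa using mt hc'.2 hu)]
        exact ih h1'.reverse a3
    · rw [List.reverse_append, List.reverse_append]
      by_cases hu : a ∈ u'
      · rw [postL_append_of_mem (by simpa), postL_append_of_mem (by simpa using hc'.1 hu)]
        exact ih b4 h1.reverse
      · rw [postL_append_of_not_mem (by simpa),
          postL_append_of_not_mem (by simpa using mt hc'.2 hu)]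
        exact a4

/-- power of a word -/
def lpow (u : List A) : ℕ → List A
  | 0 => []
  | k + 1 => u ++ lpow u k

theorem lpow_succ' (u : List A) (k : ℕ) : lpow u (k + 1) = lpow u k ++ u := by
  induction k with
  | zero => simp [lpow]
  | succ k ih =>
    rw [lpow, ih, ← List.append_assoc]
    congr 1

theorem EE.pump {u x y : List A} (hx : ∀ a ∈ x, a ∈ u) (hy : ∀ a ∈ y, a ∈ u)
    (hc : ∀ a, (x.count a : ZMod n) = (y.count a : ZMod n)) (k : ℕ) :
    EE n k (lpow u (k+1) ++ x ++ lpow u (k+1)) (lpow u (k+1) ++ y ++ lpow u (k+1)) := by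
  induction k with
  | zero =>
    refine ⟨fun a => ?_, fun a => ?_⟩
    · simp only [lpow, List.append_nil, List.mem_append]
      have := hx a
      have := hy a
      tauto
    · simp [List.count_append, hc a]
  | succ k ih =>
    set p := lpow u (k+1) with hp
    have e1 : lpow u (k+2) = u ++ p := rfl
    have e2 : lpow u (k+2) = p ++ u := lpow_succ' u (k+1)
    have hl : ∀ z, lpow u (k+2) ++ z ++ lpow u (k+2) = u ++ (p ++ z ++ p ++ u) := by
      intro z; nth_rw 1 [e1]; rw [e2]; simp
    have hr : ∀ z, (lpow u (k+2) ++ z ++ lpow u (k+2)).reverse =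
        u.reverse ++ (u ++ (p ++ z ++ p)).reverse := by
      intro z; nth_rw 1 [e1]; rw [e2]; simp
    have hl1 : EE n k (p ++ x ++ p ++ u) (p ++ y ++ p ++ u) := ih.append (EE.refl _ _)
    have hr1 : EE n k (u ++ (p ++ x ++ p)) (u ++ (p ++ y ++ p)) := (EE.refl _ _).append ih
    have hw : EE n k (lpow u (k+2) ++ x ++ lpow u (k+2)) (lpow u (k+2) ++ y ++ lpow u (k+2)) := by
      rw [hl, hl]; exact (EE.refl _ _).append hl1
    refine ⟨hw, fun a => ?_⟩
    by_cases ha : a ∈ u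
    · have ha' : a ∈ u.reverse := by simpa
      rw [hr, hr, hl, hl, preL_append_of_mem ha, preL_append_of_mem ha, preL_append_of_mem ha',
        preL_append_of_mem ha', postL_append_of_mem ha, postL_append_of_mem ha,
        postL_append_of_mem ha', postL_append_of_mem ha']
      exact ⟨EE.refl _ _, (EE.refl _ _).append hl1, EE.refl _ _, (EE.refl _ _).append hr1.reverse⟩
    · have hp' : ∀ j, a ∉ lpow u j := by
        intro j
        induction j with
        | zero => simp [lpow]
        | succ j ih => simp [lpow, ha, ih]
      have key : ∀ z : List A, (∀ b ∈ z, b ∈ u) → a ∉ lpow u (k+2) ++ z ++ lpow u (k+2) := by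
        intro z hz
        simp only [List.mem_append, not_or]
        exact ⟨⟨hp' _, fun h => ha (hz _ h)⟩, hp' _⟩
      have kx := key x hx
      have ky := key y hy
      have kx' := mt List.mem_reverse.1 kx
      have ky' := mt List.mem_reverse.1 ky
      rw [preL_of_not_mem kx, preL_of_not_mem ky, preL_of_not_mem kx', preL_of_not_mem ky',
        postL_of_not_mem kx, postL_of_not_mem ky, postL_of_not_mem kx', postL_of_not_mem ky']
      exact ⟨hw, EE.refl _ _, hw.reverse, EE.refl _ _⟩

/-- the congruence as a setoid -/
def EEs (A : Type) (n k : ℕ) : Setoid (List A) := ⟨EE n k, EE.refl k, EE.symm, EE.trans⟩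

theorem EEs_finite [Finite A] [NeZero n] (k : ℕ) : Finite (Quotient (EEs A n k)) := by
  induction k with
  | zero =>
    refine Finite.of_injective (β := Set A × (A → ZMod n))
      (Quotient.lift (fun u : List A => ({a | a ∈ u}, fun a => (u.count a : ZMod n))) ?_) ?_
    · intro u v h
      exact Prod.ext (Set.ext h.1) (funext h.2)
    · intro x y
      induction x using Quotient.inductionOn with | _ x =>
      induction y using Quotient.inductionOn with | _ y =>
      intro h
      apply Quotient.sound
      rw [Quotient.lift_mk, Quotient.lift_mk, Prod.ext_iff] at h
      exact ⟨fun a => Set.ext_iff.1 h.1 a, fun a => congrFun h.2 a⟩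
  | succ k ih =>
    let Q := Quotient (EEs A n k)
    let m : List A → Q := Quotient.mk _
    have hm : ∀ u v, m u = m v ↔ EE n k u v := fun u v => Quotient.eq
    refine Finite.of_injective (β := Q × (A → Q × Q × Q × Q))
      (Quotient.lift (fun u : List A => (m u, fun a => (m (preL a u), m (postL a u),
        m (preL a u.reverse), m (postL a u.reverse)))) ?_) ?_
    · intro u v h
      refine Prod.ext ((hm _ _).2 h.1) (funext fun a => ?_)
      simp only [Prod.mk.injEq, hm]
      exact h.2 a
    · intro x y
      induction x using Quotient.inductionOn with | _ x =>
      induction y using Quotient.inductionOn with | _ y =>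
      intro h
      apply Quotient.sound
      rw [Quotient.lift_mk, Quotient.lift_mk, Prod.ext_iff] at h
      refine ⟨(hm _ _).1 h.1, fun a => ?_⟩
      have := congrFun h.2 a
      simpa only [Prod.mk.injEq, hm] using this

def EEQ (A : Type) (n k : ℕ) : Type := Quotient (EEs A n k)

instance (k : ℕ) : Monoid (EEQ A n k) where
  mul := Quotient.map₂ (fun u v => u ++ v) (fun _ _ h _ _ h' => EE.append h h')
  one := Quotient.mk _ []
  mul_assoc x y z := by
    induction x using Quotient.inductionOn
    induction y using Quotient.inductionOn
    induction z using Quotient.inductionOn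
    exact congrArg (Quotient.mk _) (List.append_assoc _ _ _)
  one_mul x := by
    induction x using Quotient.inductionOn
    rfl
  mul_one x := by
    induction x using Quotient.inductionOn
    exact congrArg (Quotient.mk _) (List.append_nil _)

def EEQ.mk (n k : ℕ) (u : List A) : EEQ A n k := Quotient.mk (EEs A n k) u

theorem EEQ.mk_append (k : ℕ) (u v : List A) : EEQ.mk n k (u ++ v) = EEQ.mk n k u * EEQ.mk n k v :=
  rfl

theorem EEQ.mk_eq {k : ℕ} {u v : List A} : EEQ.mk n k u = EEQ.mk n k v ↔ EE n k u v := Quotient.eq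

theorem EEQ.mk_surj {k : ℕ} (x : EEQ A n k) : ∃ u, EEQ.mk n k u = x := Quotient.exists_rep x

theorem EEQ.mk_lpow (k : ℕ) (u : List A) (j : ℕ) : EEQ.mk n k (lpow u j) = EEQ.mk n k u ^ j := by
  induction j with
  | zero => rfl
  | succ j ih => rw [lpow, EEQ.mk_append, ih, pow_succ']

/-- abstract criterion for membership in the pseudovariety -/
theorem inDOAb_of {T : Type} [Monoid T] {A : Type} {n : ℕ} (hn : 0 < n)
    (c : T → Set A) (d : T → (A → ZMod n))
    (hc : ∀ x y, c (x * y) = c x ∪ c y) (hd : ∀ x y, d (x * y) = d x + d y)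
    (key : ∀ e x y : T, e * e = e → c x ⊆ c e → c y ⊆ c e → d x = d y → e * x * e = e * y * e) :
    InDOAb T := by
  -- use exponent `m = 2 * n`
  have hnn : ∀ g : A → ZMod n, (2 * n) • g = 0 := by
    intro g; ext a; simp
  have hdpow : ∀ (x : T) (j : ℕ), 0 < j → d (x ^ j) = j • d x := by
    intro x j hj
    induction j, hj using Nat.le_induction with
    | base => simp
    | succ j _ ih => rw [pow_succ, hd, ih, succ_nsmul]
  have hcpow : ∀ (x : T) (j : ℕ), 0 < j → c (x ^ j) = c x := by
    intro x j hj
    induction j, hj using Nat.le_induction with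
    | base => simp
    | succ j _ ih => rw [pow_succ, hc, ih, Set.union_self]
  have hd0 : ∀ e : T, e * e = e → d e = 0 := by
    intro e he
    have := hd e e
    rw [he] at this
    simpa using this.symm
  have hideal : ∀ x y : T, y ∈ idealGen x ↔ ∃ p q, y = p * x * q := by
    intro x y
    constructor
    · rintro (h | ⟨u, h⟩ | ⟨u, h⟩ | ⟨u, v, h⟩)
      · exact ⟨1, 1, by simp [h]⟩
      · exact ⟨1, u, by simp [h]⟩
      · exact ⟨u, 1, by simp [h]⟩
      · exact ⟨u, v, h⟩
    · rintro ⟨p, q, h⟩; exact Or.inr (Or.inr (Or.inr ⟨p, q, h⟩))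
  intro s hs
  obtain ⟨e, hes, he⟩ := hs
  replace he : e * e = e := he
  have hJ : ∀ x, x ∈ jClass s ↔ (∃ p q, x = p * e * q) ∧ c x = c e := by
    intro x
    have : jClass s = jClass e := by
      ext y; unfold jClass at *; simp only [Set.mem_ofPred_eq] at *; rw [hes]
    rw [this]
    constructor
    · intro h
      have h : idealGen x = idealGen e := h
      have h1 : x ∈ idealGen e := h ▸ Or.inl rfl
      have h2 : e ∈ idealGen x := h ▸ Or.inl rfl
      rw [hideal] at h1 h2
      refine ⟨h1, ?_⟩
      obtain ⟨p, q, h1⟩ := h1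
      obtain ⟨p', q', h2⟩ := h2
      apply Set.Subset.antisymm
      · conv_rhs => rw [h2, hc, hc]
        exact fun a ha => Or.inl (Or.inr ha)
      · conv_rhs => rw [h1, hc, hc]
        exact fun a ha => Or.inl (Or.inr ha)
    · rintro ⟨⟨p, q, h⟩, h2⟩
      have h3 : (e * x * e) ^ (2 * n) = e := by
        have e1 : (e * x * e) ^ (2 * n) = e * (e * x * e) ^ (2 * n) * e := by
          obtain ⟨j, hj⟩ := Nat.exists_eq_succ_of_ne_zero (show 2 * n ≠ 0 by omega)
          rw [hj, Nat.succ_eq_add_one]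
          have a1 : e * (e * x * e) ^ (j + 1) = (e * x * e) ^ (j + 1) := by
            rw [pow_succ']; simp only [← mul_assoc, he]
          have a2 : (e * x * e) ^ (j + 1) * e = (e * x * e) ^ (j + 1) := by
            rw [pow_succ]; simp only [mul_assoc, he]
          rw [a1, a2]
        rw [e1, key e _ e he _ subset_rfl, he, he]
        · rw [hdpow _ _ (by omega), hnn, hd0 e he]
        · rw [hcpow _ _ (by omega), hc, hc, h2]; simp
      have h4 : e ∈ idealGen x := by
        rw [hideal]
        obtain ⟨j, hj⟩ := Nat.exists_eq_succ_of_ne_zero (show 2 * n ≠ 0 by omega)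
        refine ⟨(e * x * e) ^ j * e, e, ?_⟩
        conv_lhs => rw [← h3, hj, pow_succ]
        simp only [mul_assoc]
      rw [hideal] at h4
      obtain ⟨p', q', h4⟩ := h4
      show idealGen x = idealGen e
      ext y
      rw [hideal, hideal]
      constructor
      · rintro ⟨r, t, hy⟩; exact ⟨r * p, q * t, by rw [hy, h]; simp only [mul_assoc]⟩
      · rintro ⟨r, t, hy⟩; exact ⟨r * p', q' * t, by rw [hy, h4]; simp only [mul_assoc]⟩
  have hJc : ∀ x, x ∈ jClass s → c x = c e := fun x hx => ((hJ x).1 hx).2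
  have hmul : ∀ x ∈ jClass s, ∀ y ∈ jClass s, x * y ∈ jClass s := by
    intro x hx y hy
    rw [hJ] at *
    obtain ⟨⟨p, q, h⟩, h2⟩ := hx
    refine ⟨⟨p, q * y, by rw [h]; simp only [mul_assoc]⟩, by rw [hc, h2, hy.2, Set.union_self]⟩
  have hpowJ : ∀ x ∈ jClass s, ∀ j, 0 < j → x ^ j ∈ jClass s := by
    intro x hx j hj
    induction j, hj using Nat.le_induction with
    | base => simpa
    | succ j _ ih => rw [pow_succ]; exact hmul _ ih _ hx
  have heJ : e ∈ jClass s := (hJ e).2 ⟨⟨1, 1, by simp⟩, rfl⟩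
  have hx1 : ∀ x ∈ jClass s, x ^ (2 * n + 1) = x := by
    intro x hx
    obtain ⟨⟨p, q, h⟩, h2⟩ := (hJ x).1 hx
    have hcx : c p ∪ c e ∪ c q = c e := by rw [← hc, ← hc, ← h, h2]
    have h3 : e * (q * x ^ (2 * n - 1) * p) * e = e := by
      rw [key e _ e he _ subset_rfl, he, he]
      · rw [hd, hd, hdpow _ _ (by omega), hd0 e he]
        have h4 : d x = d p + d q := by rw [h, hd, hd, hd0 e he, add_zero]
        have h5 : d q + (2 * n - 1) • d x + d p = (2 * n) • d x := by
          obtain ⟨j, hj⟩ := Nat.exists_eq_succ_of_ne_zero (show 2 * n ≠ 0 by omega)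
          rw [hj, Nat.succ_eq_add_one, Nat.add_sub_cancel, succ_nsmul]
          nth_rw 3 [h4]
          abel
        rw [h5, hnn]
      · rw [hc, hc, hcpow _ _ (by omega), h2, ← hcx]
        intro a ha
        simp only [Set.mem_union] at *
        tauto
    have h6 : x ^ (2 * n + 1) = x * x ^ (2 * n - 1) * x := by
      rw [← pow_succ', ← pow_succ]; congr 1; omega
    rw [h6]
    calc x * x ^ (2 * n - 1) * x = (p * e * q) * x ^ (2 * n - 1) * (p * e * q) := by rw [← h]
      _ = p * (e * (q * x ^ (2 * n - 1) * p) * e) * q := by simp only [mul_assoc]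
      _ = x := by rw [h3, ← h]
  have hxi : ∀ x ∈ jClass s, x ^ (2 * n) * x ^ (2 * n) = x ^ (2 * n) := by
    intro x hx
    rw [← pow_add, show 2 * n + 2 * n = (2 * n + 1) + (2 * n - 1) by omega, pow_add, hx1 x hx,
      ← pow_succ']
    congr 1; omega
  have hrect : ∀ i ∈ jClass s, ∀ j ∈ jClass s, i * i = i → j * j = j → i * j * i = i := by
    intro i hi j hj hii hjj
    rw [key i j i hii _ subset_rfl, hii, hii]
    · rw [hd0 i hii, hd0 j hjj]
    · rw [hJc i hi, hJc j hj]
  let B : Type := {i : T // i ∈ jClass s ∧ i * i = i}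
  let iB : Semigroup B :=
    { mul := fun i j => ⟨i.1 * j.1, hmul _ i.2.1 _ j.2.1, by
        have := hrect i.1 i.2.1 j.1 j.2.1 i.2.2 j.2.2
        rw [← mul_assoc, this]⟩
      mul_assoc := fun i j k => Subtype.ext (mul_assoc _ _ _) }
  let H : AddSubgroup (A → ZMod n) :=
    { carrier := {g | ∃ y ∈ jClass s, d y = g}
      add_mem' := by
        rintro _ _ ⟨y, hy, rfl⟩ ⟨z, hz, rfl⟩
        exact ⟨y * z, hmul _ hy _ hz, hd _ _⟩
      zero_mem' := ⟨e, heJ, hd0 e he⟩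
      neg_mem' := by
        rintro _ ⟨y, hy, rfl⟩
        refine ⟨y ^ (2 * n - 1), hpowJ y hy _ (by omega), ?_⟩
        rw [hdpow _ _ (by omega), eq_neg_iff_add_eq_zero, ← succ_nsmul,
          show 2 * n - 1 + 1 = 2 * n by omega, hnn] }
  have hB : ∀ i j : B, i * j * i = i := fun i j =>
    Subtype.ext (hrect i.1 i.2.1 j.1 j.2.1 i.2.2 j.2.2)
  have hB3 : ∀ i j k : B, i * j * k = i * k := by
    intro a c b
    calc a * c * b = a * c * (b * a * b) := by rw [hB]
      _ = (a * (c * b) * a) * b := by simp only [mul_assoc]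
      _ = _ := by rw [hB]
  let ι : ∀ x, x ∈ jClass s → B := fun x hx => ⟨x ^ (2 * n), hpowJ x hx _ (by omega), hxi x hx⟩
  have hι : ∀ x y (hx : x ∈ jClass s) (hy : y ∈ jClass s),
      ι (x * y) (hmul x hx y hy) = ι x hx * ι y hy := by
    intro x y hx hy
    rw [← hB3 (ι x hx) (ι (x * y) (hmul x hx y hy)) (ι y hy)]
    apply Subtype.ext
    show (x * y) ^ (2 * n) = x ^ (2 * n) * (x * y) ^ (2 * n) * y ^ (2 * n)
    obtain ⟨j, hj⟩ := Nat.exists_eq_succ_of_ne_zero (show 2 * n ≠ 0 by omega)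
    have a1 : x ^ (2 * n) * (x * y) ^ (2 * n) = (x * y) ^ (2 * n) := by
      conv_lhs => rw [show (x * y) ^ (2 * n) = x * y * (x * y) ^ j by rw [hj, pow_succ']]
      rw [← mul_assoc, ← mul_assoc, ← pow_succ, hx1 x hx, ← pow_succ', hj]
    have a2 : (x * y) ^ (2 * n) * y ^ (2 * n) = (x * y) ^ (2 * n) := by
      conv_lhs => rw [show (x * y) ^ (2 * n) = (x * y) ^ j * (x * y) by rw [hj, pow_succ]]
      rw [mul_assoc, mul_assoc, ← pow_succ', hx1 y hy, ← pow_succ, hj]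
    rw [a1, a2]
  refine ⟨hmul, B, Multiplicative H, iB, inferInstance, hB,
    fun x => (ι x.1 x.2, Multiplicative.ofAdd ⟨d x.1, x.1, x.2, rfl⟩), ⟨?_, ?_⟩, ?_⟩
  · rintro ⟨x, hx⟩ ⟨y, hy⟩ h
    simp only [Prod.mk.injEq, EmbeddingLike.apply_eq_iff_eq, Subtype.mk.injEq, ι] at h
    apply Subtype.ext
    have e1 : ∀ z ∈ jClass s, z = z ^ (2 * n) * z * z ^ (2 * n) := by
      intro z hz
      rw [← pow_succ, hx1 z hz, ← pow_succ', hx1 z hz]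
    show x = y
    have h1 : x ^ (2 * n) = y ^ (2 * n) := congrArg Subtype.val h.1
    rw [e1 x hx, e1 y hy, ← h1]
    apply key _ _ _ (hxi x hx) _ _ h.2
    · rw [hcpow _ _ (by omega)]
    · rw [hcpow _ _ (by omega), hJc x hx, hJc y hy]
  · rintro ⟨⟨b, hb, hbb⟩, ⟨g, y, hy, rfl⟩⟩
    refine ⟨⟨b * y * b, hmul _ (hmul _ hb _ hy) _ hb⟩, ?_⟩
    refine Prod.ext ?_ ?_
    · show ι (b * y * b) (hmul _ (hmul _ hb _ hy) _ hb) = _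
      rw [hι _ _ (hmul _ hb _ hy) hb, hι _ _ hb hy, hB]
      apply Subtype.ext
      show b ^ (2 * n) = b
      exact IsIdempotentElem.pow_eq hbb (by omega)
    · apply Subtype.ext
      show d (b * y * b) = d y
      rw [hd, hd, hd0 b hbb]; simp
  · intro x y hx hy hxy
    refine Prod.ext (hι x y hx hy) ?_
    apply Subtype.ext
    exact hd x y

theorem EEQ_inDOAb (hn : 0 < n) (k : ℕ) : InDOAb (EEQ A n k) := by
  let c : EEQ A n k → Set A := Quotient.lift (fun u : List A => {a | a ∈ u})
    (fun u v h => Set.ext (EE.zero h).1)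
  let d : EEQ A n k → (A → ZMod n) := Quotient.lift (fun u : List A => fun a => (u.count a : ZMod n))
    (fun u v h => funext (EE.zero h).2)
  refine inDOAb_of hn c d ?_ ?_ ?_
  · intro x y
    obtain ⟨u, rfl⟩ := EEQ.mk_surj x
    obtain ⟨v, rfl⟩ := EEQ.mk_surj y
    show {a | a ∈ u ++ v} = {a | a ∈ u} ∪ {a | a ∈ v}
    ext a; simp
  · intro x y
    obtain ⟨u, rfl⟩ := EEQ.mk_surj x
    obtain ⟨v, rfl⟩ := EEQ.mk_surj y
    funext a
    show ((u ++ v).count a : ZMod n) = (u.count a : ZMod n) + (v.count a : ZMod n)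
    simp
  · intro e x y he hx hy hxy
    obtain ⟨u, rfl⟩ := EEQ.mk_surj e
    obtain ⟨x, rfl⟩ := EEQ.mk_surj x
    obtain ⟨y, rfl⟩ := EEQ.mk_surj y
    have h := EE.pump (n := n) (u := u) (x := x) (y := y) (fun a ha => hx ha) (fun a ha => hy ha)
      (fun a => congrFun hxy a) k
    rw [← EEQ.mk_eq] at h
    have h2 : EEQ.mk n k u ^ (k + 1) = EEQ.mk n k u := IsIdempotentElem.pow_eq he (by omega)
    simpa only [EEQ.mk_append, EEQ.mk_lpow, h2] using h

end words


open Filter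

theorem ultra_const {β : Type} [Finite β] (U : Ultrafilter ℕ) (f : ℕ → β) :
    ∃ b, ∀ᶠ N in (U : Filter ℕ), f N = b := by
  obtain ⟨b, hb⟩ := Ultrafilter.eq_pure_of_finite (U.map f)
  refine ⟨b, ?_⟩
  have : ({b} : Set β) ∈ U.map f := by rw [hb]; exact rfl
  exact this

theorem fg_divisible {Q : Type} [AddCommGroup Q] [AddGroup.FG Q] (x : Q)
    (h : ∀ n : ℕ, 0 < n → ∃ z : Q, x = n • z) : x = 0 := by
  obtain ⟨r, ι, _, p, hp, e, ⟨φ⟩⟩ := AddCommGroup.equiv_free_prod_directSum_zmod Q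
  apply φ.injective
  rw [map_zero]
  have h' : ∀ n : ℕ, 0 < n → ∃ z, φ x = n • z := by
    intro n hn
    obtain ⟨z, hz⟩ := h n hn
    exact ⟨φ z, by rw [hz, map_nsmul]⟩
  refine Prod.ext ?_ ?_
  · ext i
    obtain ⟨z, hz⟩ := h' (((φ x).1 i).natAbs + 1) (by omega)
    have h1 : (φ x).1 i = ((((φ x).1 i).natAbs + 1 : ℕ) : ℤ) * z.1 i := by
      conv_lhs => rw [hz]
      simp
    apply Int.eq_zero_of_abs_lt_dvd (Dvd.intro _ h1.symm)
    rw [Int.abs_eq_natAbs]; omega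
  · classical
    obtain ⟨z, hz⟩ := h' (∏ i, p i ^ e i) (Finset.prod_pos fun i _ => pow_pos (hp i).pos _)
    rw [hz]
    refine DFinsupp.ext fun i => ?_
    obtain ⟨m, hm⟩ : p i ^ e i ∣ ∏ i, p i ^ e i := Finset.dvd_prod_of_mem _ (Finset.mem_univ i)
    have h2 : ((∏ i, p i ^ e i : ℕ) : ZMod (p i ^ e i)) = 0 :=
      (ZMod.natCast_eq_zero_iff _ _).2 ⟨m, hm⟩
    show (∏ i, p i ^ e i) • (z.2 i) = 0
    rw [nsmul_eq_mul, h2, zero_mul]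

theorem fg_closed {G : Type} [AddCommGroup G] [AddGroup.FG G] (H : AddSubgroup G) (x : G)
    (h : ∀ n : ℕ, 0 < n → ∃ y ∈ H, ∃ z, x = y + n • z) : x ∈ H := by
  have : AddGroup.FG (G ⧸ H) := inferInstance
  rw [← QuotientAddGroup.eq_zero_iff]
  apply fg_divisible
  intro n hn
  obtain ⟨y, hy, z, hz⟩ := h n hn
  refine ⟨(z : G ⧸ H), ?_⟩
  have h0 : (y : G ⧸ H) = 0 := (QuotientAddGroup.eq_zero_iff _).2 hy
  rw [hz, QuotientAddGroup.mk_add, h0, zero_add]; rfl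

section lat
variable {A I : Type}

def Dv (n : ℕ) (x : A → ℤ) : Prop := ∀ i, (n : ℤ) ∣ x i

theorem Dv.add {n : ℕ} {x y : A → ℤ} (hx : Dv n x) (hy : Dv n y) : Dv n (x + y) :=
  fun i => dvd_add (hx i) (hy i)

theorem Dv.sub {n : ℕ} {x y : A → ℤ} (hx : Dv n x) (hy : Dv n y) : Dv n (x - y) :=
  fun i => dvd_sub (hx i) (hy i)

theorem Dv.neg {n : ℕ} {x : A → ℤ} (hx : Dv n x) : Dv n (-x) := fun i => (dvd_neg).2 (hx i)

theorem Dv.exists {n : ℕ} {x : A → ℤ} (hx : Dv n x) : ∃ z : A → ℤ, x = n • z := by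
  choose z hz using hx
  exact ⟨z, by ext i; simp [hz i]⟩

theorem Dv_zero (n : ℕ) : Dv n (0 : A → ℤ) := fun _ => dvd_zero _

theorem closed_sub [Finite A] (H : AddSubgroup (A → ℤ)) (x : A → ℤ)
    (h : ∀ n : ℕ, 0 < n → ∃ y ∈ H, Dv n (x - y)) : x ∈ H := by
  have : Module.Finite ℤ (A → ℤ) := inferInstance
  have : AddGroup.FG (A → ℤ) := (Module.Finite.iff_addGroup_fg).1 this
  apply fg_closed
  intro n hn
  obtain ⟨y, hy, hd⟩ := h n hn
  obtain ⟨z, hz⟩ := hd.exists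
  exact ⟨y, hy, z, by rw [← hz]; abel⟩

theorem lattice0 [Finite A] [Finite I] (a : I → A → ℤ) (Λ : I → AddSubgroup (A → ℤ))
    [Nonempty I]
    (h : ∀ n : ℕ, 0 < n → ∃ d : I → A → ℤ, (∀ p, d p - a p ∈ Λ p) ∧ ∀ p q, Dv n (d p - d q)) :
    ∃ c, ∀ p, c - a p ∈ Λ p := by
  have : Module.Finite ℤ (I → A → ℤ) := inferInstance
  have : AddGroup.FG (I → A → ℤ) := (Module.Finite.iff_addGroup_fg).1 this
  obtain ⟨p0⟩ := ‹Nonempty I›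
  let H : AddSubgroup (I → A → ℤ) :=
    { carrier := {x | ∃ c, ∀ p, c - x p ∈ Λ p}
      zero_mem' := ⟨0, fun p => by simp⟩
      add_mem' := by
        rintro x y ⟨c, hc⟩ ⟨c', hc'⟩
        refine ⟨c + c', fun p => ?_⟩
        have := (Λ p).add_mem (hc p) (hc' p)
        rw [Pi.add_apply]; convert this using 1; abel
      neg_mem' := by
        rintro x ⟨c, hc⟩
        refine ⟨-c, fun p => ?_⟩
        have := (Λ p).neg_mem (hc p)
        rw [Pi.neg_apply]; convert this using 1; abel }
  show a ∈ H
  apply fg_closed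
  intro n hn
  obtain ⟨d, hd, hdd⟩ := h n hn
  choose z hz using fun p => (hdd p p0).exists
  refine ⟨fun p => a p - n • z p, ⟨d p0, fun p => ?_⟩, z, ?_⟩
  · have := hd p
    have e : d p0 - (a p - n • z p) = d p - a p := by rw [← hz p]; abel
    rw [e]; exact this
  · ext p; simp

theorem Dv_of_zmod {n : ℕ} {x y : A → ℤ} (h : ∀ i, (x i : ZMod n) = (y i : ZMod n)) :
    Dv n (x - y) := fun i => by
  rw [Pi.sub_apply, ← ZMod.intCast_zmod_eq_zero_iff_dvd]; simp [h i]

theorem lattice1 [Finite A] [Finite I] [Nonempty I] (U : Ultrafilter ℕ)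
    (a : I → A → ℤ) (Λ : I → AddSubgroup (A → ℤ)) (d : ℕ → I → A → ℤ)
    (hd : ∀ᶠ N in (U : Filter ℕ), ∀ p, d N p - a p ∈ Λ p)
    (he : ∀ n : ℕ, 0 < n → ∀ᶠ N in (U : Filter ℕ), ∀ p q, Dv n (d N p - d N q)) :
    ∃ c, (∀ p, c - a p ∈ Λ p) ∧ ∀ n : ℕ, 0 < n → ∀ᶠ N in (U : Filter ℕ),
      ∃ h ∈ ⨅ p, Λ p, ∀ p, Dv n (d N p - (c + h)) := by
  obtain ⟨c, hc⟩ := lattice0 a Λ (fun n hn => by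
    obtain ⟨N, h1, h2⟩ := (hd.and (he n hn)).exists
    exact ⟨d N, h1, h2⟩)
  refine ⟨c, hc, fun n hn => ?_⟩
  have p0 : I := Classical.arbitrary I
  have : NeZero n := ⟨hn.ne'⟩
  obtain ⟨b, hb⟩ := ultra_const U (fun N => fun i : A => (d N p0 i : ZMod n))
  obtain ⟨N0, ⟨h1, h2⟩, h3⟩ := ((hd.and (he n hn)).and hb).exists
  -- new cosets
  have hN : ∀ᶠ N in (U : Filter ℕ), ∀ p, Dv n (d N p - d N0 p) := by
    filter_upwards [he n hn, hb] with N h4 h5 p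
    have h6 : Dv n (d N p0 - d N0 p0) := Dv_of_zmod fun i => by
      have := congrFun h5 i
      rw [← h3] at this
      exact this
    have := ((h4 p p0).add h6).add (h2 p0 p)
    convert this using 1; abel
  let Dn : AddSubgroup (A → ℤ) :=
    { carrier := {x | Dv n x}
      zero_mem' := Dv_zero n
      add_mem' := fun hx hy => hx.add hy
      neg_mem' := fun hx => hx.neg }
  obtain ⟨c', hc'⟩ := lattice0 (fun p => d N0 p - c) (fun p => Λ p ⊓ Dn) (fun m hm => by
    obtain ⟨N, ⟨g1, g2⟩, g3⟩ := ((hd.and (he m hm)).and hN).exists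
    refine ⟨fun p => d N p - c, fun p => ⟨?_, ?_⟩, fun p q => ?_⟩
    · have := (Λ p).sub_mem (g1 p) (h1 p)
      show (d N p - c) - (d N0 p - c) ∈ Λ p
      convert this using 1; abel
    · have := g3 p
      show Dv n ((d N p - c) - (d N0 p - c))
      convert this using 1; abel
    · have := g2 p q
      show Dv m ((d N p - c) - (d N q - c))
      convert this using 1; abel)
  filter_upwards [hN] with N hN
  refine ⟨c', ?_, fun p => ?_⟩
  · rw [AddSubgroup.mem_iInf]
    intro p
    have := (Λ p).add_mem (hc' p).1 ((Λ p).sub_mem (h1 p) (hc p))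
    convert this using 1; abel
  · have g := (hc' p).2
    have g : Dv n (c' - (d N0 p - c)) := g
    have := (hN p).sub g
    convert this using 1; abel

end lat

section ab
variable {A M : Type} [Monoid M]

def val (f : A → M) (u : List A) : M := (u.map f).prod

theorem val_append (f : A → M) (u v : List A) : val f (u ++ v) = val f u * val f v := by
  simp [val]

theorem val_singleton (f : A → M) (a : A) : val f [a] = f a := by simp [val]

open Classical in
noncomputable def cw (u : List A) : A → ℤ := fun a => (u.count a : ℤ)

theorem cw_append (u v : List A) : cw (u ++ v) = cw u + cw v := by
  ext a; simp [cw]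

theorem cw_nil : cw ([] : List A) = 0 := by ext a; simp [cw]

open Classical in
theorem cw_singleton (a : A) : cw [a] = Pi.single a 1 := by
  ext b
  by_cases h : b = a
  · subst h; simp [cw]
  · have h' : ¬ (a = b) := fun e => h e.symm
    simp [cw, h, h']

def wt : List A → MTerm A
  | [] => MTerm.one
  | a :: u => MTerm.mul (MTerm.letter a) (wt u)

theorem wt_cont (u : List A) : (wt u).cont = {a | a ∈ u} := by
  induction u with
  | nil => simp [wt, MTerm.cont]
  | cons a u ih => ext b; simp [wt, MTerm.cont, ih]

theorem wt_eval (K : ℕ) (f : A → M) (u : List A) : (wt u).eval K f = val f u := by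
  induction u with
  | nil => simp [wt, MTerm.eval, val]
  | cons a u ih => simp [wt, MTerm.eval, ih, val]

theorem wt_cnt (u : List A) : (wt u).cnt = cw u := by
  induction u with
  | nil => simp [wt, MTerm.cnt, cw_nil]
  | cons a u ih =>
    rw [wt, MTerm.cnt, MTerm.cnt, ih, ← List.singleton_append, cw_append, cw_singleton]

def KS (K : ℕ) (f : A → M) (D : Set A) (v v' : M) (c : A → ℤ) : Prop :=
  ∃ w : MTerm A, w.cont ⊆ D ∧ v * w.eval K f = v' ∧ w.cnt = c

theorem KS.trans {K : ℕ} {f : A → M} {D : Set A} {v v' v'' : M} {c c' : A → ℤ}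
    (h : KS K f D v v' c) (h' : KS K f D v' v'' c') : KS K f D v v'' (c + c') := by
  obtain ⟨w, h1, h2, h3⟩ := h
  obtain ⟨w', h1', h2', h3'⟩ := h'
  refine ⟨w.mul w', Set.union_subset h1 h1', ?_, by rw [MTerm.cnt, h3, h3']⟩
  rw [MTerm.eval, ← mul_assoc, h2, h2']

theorem KS.word {K : ℕ} {f : A → M} {D : Set A} {v v' : M} {u : List A}
    (hu : ∀ a ∈ u, a ∈ D) (h : v * val f u = v') : KS K f D v v' (cw u) :=
  ⟨wt u, by rw [wt_cont]; exact hu, by rw [wt_eval]; exact h, wt_cnt u⟩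

def stab (K : ℕ) (f : A → M) (D : Set A) (v : M) : AddSubgroup (A → ℤ) where
  carrier := {c | KS K f D v v c}
  zero_mem' := ⟨MTerm.one, by simp [MTerm.cont], by simp [MTerm.eval], rfl⟩
  add_mem' := fun h h' => h.trans h'
  neg_mem' := by
    rintro c ⟨w, h1, h2, h3⟩
    refine ⟨w.pow, h1, ?_, by rw [MTerm.cnt, h3]⟩
    rw [MTerm.eval]
    generalize 2 * K - 1 = j
    induction j with
    | zero => simp
    | succ j ih => rw [pow_succ, ← mul_assoc, ih, h2]

def Reach (f : A → M) (D : Set A) (v : M) : Set M :=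
  {x | ∃ u : List A, (∀ a ∈ u, a ∈ D) ∧ v * val f u = x}

theorem Reach.trans {f : A → M} {D : Set A} {v v' v'' : M} (h : v' ∈ Reach f D v)
    (h' : v'' ∈ Reach f D v') : v'' ∈ Reach f D v := by
  obtain ⟨u, h1, h2⟩ := h
  obtain ⟨u', h1', h2'⟩ := h'
  refine ⟨u ++ u', ?_, by rw [val_append, ← mul_assoc, h2, h2']⟩
  intro a ha
  rcases List.mem_append.1 ha with h | h
  · exact h1 a h
  · exact h1' a h

theorem split_pred {P : List A → Prop} (z : List A) (h0 : P []) (hz : ¬ P z) :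
    ∃ x a y, z = x ++ [a] ++ y ∧ P x ∧ ¬ P (x ++ [a]) := by
  induction z using List.reverseRecOn with
  | nil => exact absurd h0 hz
  | append_singleton z b ih =>
    by_cases h : P z
    · exact ⟨z, b, [], by simp, h, hz⟩
    · obtain ⟨x, a, y, h1, h2, h3⟩ := ih h
      exact ⟨x, a, y ++ [b], by rw [h1]; simp, h2, h3⟩

/-- the data approximating a sequence of words, starting at state `v` -/
def AbData (U : Ultrafilter ℕ) (K : ℕ) (f : A → M) (D : Set A) (v : M) (z : ℕ → List A) : Prop :=
  ∃ v' a, ∃ Λ : AddSubgroup (A → ℤ), (∀ᶠ N in (U : Filter ℕ), v * val f (z N) = v') ∧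
    (∀ᶠ N in (U : Filter ℕ), cw (z N) - a ∈ Λ) ∧ ∀ h ∈ Λ, KS K f D v v' (a + h)

theorem ab_scc [Finite M] (U : Ultrafilter ℕ) (K : ℕ) (f : A → M) (D : Set A) (v : M)
    (z : ℕ → List A) (hz : ∀ᶠ N in (U : Filter ℕ), ∀ a ∈ z N, a ∈ D)
    (hr : ∀ᶠ N in (U : Filter ℕ), v ∈ Reach f D (v * val f (z N))) : AbData U K f D v z := by
  obtain ⟨v', hv'⟩ := ultra_const U (fun N => v * val f (z N))
  obtain ⟨N0, ⟨h1, h2⟩, h3⟩ := ((hz.and hr).and hv').exists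
  obtain ⟨b, hb1, hb2⟩ := h2
  refine ⟨v', cw (z N0), stab K f D v, hv', ?_, ?_⟩
  · filter_upwards [hz, hv'] with N g1 g2
    have k1 : cw (z N) + cw b ∈ stab K f D v :=
      (KS.word g1 g2).trans (KS.word hb1 (by rw [← h3]; exact hb2))
    have k2 : cw (z N0) + cw b ∈ stab K f D v :=
      (KS.word h1 h3).trans (KS.word hb1 (by rw [← h3]; exact hb2))
    have := (stab K f D v).sub_mem k1 k2
    convert this using 1; abel
  · intro h hh
    rw [add_comm]
    exact KS.trans (show KS K f D v v h from hh) (KS.word h1 h3)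

theorem ab_main [Finite A] [Finite M] (U : Ultrafilter ℕ) (K : ℕ) (f : A → M) (D : Set A) (v : M)
    (z : ℕ → List A) (hz : ∀ᶠ N in (U : Filter ℕ), ∀ a ∈ z N, a ∈ D) : AbData U K f D v z := by
  induction hk : (Reach f D v).ncard using Nat.strong_induction_on generalizing v z with
  | _ k ih =>
  by_cases hr : ∀ᶠ N in (U : Filter ℕ), v ∈ Reach f D (v * val f (z N))
  · exact ab_scc U K f D v z hz hr
  have hr' : ∀ᶠ N in (U : Filter ℕ), ¬ v ∈ Reach f D (v * val f (z N)) :=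
    Ultrafilter.eventually_not.2 hr
  have h0 : ∀ N, ∃ x y, ∃ a, ¬ v ∈ Reach f D (v * val f (z N)) → z N = x ++ [a] ++ y ∧
      v ∈ Reach f D (v * val f x) ∧ ¬ v ∈ Reach f D (v * val f (x ++ [a])) := by
    intro N
    by_cases hN : v ∈ Reach f D (v * val f (z N))
    · rcases hr'.exists with ⟨N', hN'⟩
      have : Nonempty A := by
        by_contra hA
        rw [not_nonempty_iff] at hA
        apply hN'
        have : z N' = [] := by
          cases hzz : z N' with
          | nil => rfl
          | cons a _ => exact (hA.false a).elim
        rw [this]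
        exact ⟨[], by simp, by simp [val]⟩
      exact ⟨[], [], Classical.arbitrary A, fun h => absurd hN h⟩
    · obtain ⟨x, a, y, h⟩ := split_pred (P := fun x => v ∈ Reach f D (v * val f x)) (z N)
        ⟨[], by simp, by simp [val]⟩ hN
      exact ⟨x, y, a, fun _ => h⟩
  choose x y a h using h0
  obtain ⟨a0, ha0⟩ := ultra_const U a
  have hx : ∀ᶠ N in (U : Filter ℕ), ∀ b ∈ x N, b ∈ D := by
    filter_upwards [hz, hr'] with N h1 h2 b hb
    apply h1; rw [(h N h2).1]; simp [hb]
  have hy : ∀ᶠ N in (U : Filter ℕ), ∀ b ∈ y N, b ∈ D := by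
    filter_upwards [hz, hr'] with N h1 h2 b hb
    apply h1; rw [(h N h2).1]; simp [hb]
  obtain ⟨v1, c1, Λ1, p1, q1, r1⟩ := ab_scc U K f D v x hx (by
    filter_upwards [hr'] with N h2
    exact (h N h2).2.1)
  obtain ⟨N0, ⟨⟨⟨hN1, hN2⟩, hN3⟩, hN4⟩, hN5⟩ := ((((hz.and hr').and ha0).and hx).and p1).exists
  obtain ⟨g1, g2, g3⟩ := h N0 hN2
  have haD : a0 ∈ D := by rw [← hN3]; apply hN1; rw [g1]; simp
  have hv2 : v * val f (x N0 ++ [a N0]) = v1 * f a0 := by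
    rw [val_append, val_singleton, ← mul_assoc, hN5, hN3]
  rw [hv2] at g3
  have hlt : (Reach f D (v1 * f a0)).ncard < k := by
    rw [← hk]
    apply Set.ncard_lt_ncard _ (Set.toFinite _)
    refine ⟨fun w hw => ?_, fun hsub => g3 (hsub ⟨[], by simp, by simp [val]⟩)⟩
    refine Reach.trans ⟨x N0 ++ [a0], ?_, ?_⟩ hw
    · intro b hb
      rcases List.mem_append.1 hb with hb | hb
      · exact hN4 b hb
      · rw [List.mem_singleton.1 hb]; exact haD
    · rw [← hv2, hN3]
  obtain ⟨v3, c3, Λ3, p3, q3, r3⟩ := ih _ hlt (v1 * f a0) y hy rfl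
  refine ⟨v3, c1 + cw [a0] + c3, Λ1 ⊔ Λ3, ?_, ?_, ?_⟩
  · filter_upwards [hr', p1, p3, ha0] with N k1 k2 k3 k4
    rw [(h N k1).1, val_append, val_append, val_singleton, k4, ← mul_assoc, ← mul_assoc, k2, k3]
  · filter_upwards [hr', q1, q3, ha0] with N k1 k2 k3 k4
    rw [(h N k1).1, cw_append, cw_append, k4]
    have := add_mem (AddSubgroup.mem_sup_left (T := Λ3) k2) (AddSubgroup.mem_sup_right (S := Λ1) k3)
    convert this using 1; abel
  · intro h hh
    obtain ⟨h1, hh1, h3, hh3, rfl⟩ := AddSubgroup.mem_sup.1 hh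
    have := ((r1 h1 hh1).trans (KS.word (K := K) (u := [a0]) (v' := v1 * f a0) (by simpa using haD)
      (by rw [val_singleton]))).trans (r3 h3 hh3)
    convert this using 1; abel

end ab


open Filter

section core
variable {A I M : Type} [Monoid M]

def VEq (w : I → MTerm A) : Prop :=
  ∀ (T : Type) [Semigroup T], InDOAb T → ∀ (g : A → T) (K : ℕ), GoodExp K (WithOne T) →
    ∀ p q, (w p).eval K (fun a => (g a : WithOne T)) = (w q).eval K (fun a => (g a : WithOne T))

def VIdem (w : I → MTerm A) : Prop :=
  ∀ (T : Type) [Semigroup T], InDOAb T → ∀ (g : A → T) (K : ℕ), GoodExp K (WithOne T) →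
    ∀ p, IsIdempotentElem ((w p).eval K (fun a => (g a : WithOne T)))

def Good (b : Prop) (K : ℕ) (f : A → M) (D : Set A) (s : I → M) (c : A → ℤ) : Prop :=
  ∃ w : I → MTerm A, (∀ p, (w p).cont = D) ∧ (∀ p, (w p).cnt = c) ∧ (∀ p, (w p).eval K f = s p) ∧
    VEq w ∧ (b → c = 0 → VIdem w)

theorem Good.mul {b b' : Prop} {K : ℕ} {f : A → M} {D D' : Set A} {s s' : I → M} {c c' : A → ℤ}
    (h : Good b K f D s c) (h' : Good b' K f D' s' c') :
    Good False K f (D ∪ D') (s * s') (c + c') := by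
  obtain ⟨w, h1, h2, h3, h4, -⟩ := h
  obtain ⟨w', h1', h2', h3', h4', -⟩ := h'
  refine ⟨fun p => (w p).mul (w' p), fun p => ?_, fun p => ?_, fun p => ?_, ?_, False.elim⟩
  · rw [MTerm.cont, h1, h1']
  · rw [MTerm.cnt, h2, h2']
  · rw [MTerm.eval, h3, h3']; rfl
  · intro T _ hT g K' hK' p q
    rw [MTerm.eval, MTerm.eval, h4 T hT g K' hK' p q, h4' T hT g K' hK' p q]

def Ap (b : Prop) (U : Ultrafilter ℕ) (K : ℕ) (f : A → M) (D : Set A) (u : ℕ → I → List A) : Prop :=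
  ∃ (s : I → M) (c : A → ℤ) (H : AddSubgroup (A → ℤ)),
    (∀ h ∈ H, Good b K f D s (c + h)) ∧
    (∀ᶠ N in (U : Filter ℕ), ∀ p, val f (u N p) = s p) ∧
    ∀ n : ℕ, 0 < n → ∀ᶠ N in (U : Filter ℕ), ∃ h ∈ H, ∀ p, Dv n (cw (u N p) - (c + h))

variable {U : Ultrafilter ℕ} {K : ℕ} {f : A → M}

theorem Ap.weaken {b : Prop} {D : Set A} {u : ℕ → I → List A} (h : Ap b U K f D u) :
    Ap False U K f D u := by
  obtain ⟨s, c, H, h1, h2, h3⟩ := h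
  refine ⟨s, c, H, fun h hh => ?_, h2, h3⟩
  obtain ⟨w, g1, g2, g3, g4, -⟩ := h1 h hh
  exact ⟨w, g1, g2, g3, g4, False.elim⟩

theorem Ap.congr {b : Prop} {D : Set A} {u u' : ℕ → I → List A} (h : Ap b U K f D u)
    (hu : ∀ᶠ N in (U : Filter ℕ), ∀ p, u' N p = u N p) : Ap b U K f D u' := by
  obtain ⟨s, c, H, h1, h2, h3⟩ := h
  refine ⟨s, c, H, h1, ?_, fun n hn => ?_⟩
  · filter_upwards [h2, hu] with N k1 k2 p
    rw [k2, k1]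
  · filter_upwards [h3 n hn, hu] with N k1 k2
    simpa only [k2] using k1

theorem Ap.mul {b b' : Prop} {D D' : Set A} {u u' : ℕ → I → List A} (h : Ap b U K f D u)
    (h' : Ap b' U K f D' u') : Ap False U K f (D ∪ D') (fun N p => u N p ++ u' N p) := by
  obtain ⟨s, c, H, h1, h2, h3⟩ := h
  obtain ⟨s', c', H', h1', h2', h3'⟩ := h'
  refine ⟨s * s', c + c', H ⊔ H', fun h hh => ?_, ?_, fun n hn => ?_⟩
  · obtain ⟨x, hx, y, hy, rfl⟩ := AddSubgroup.mem_sup.1 hh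
    have := (h1 x hx).mul (h1' y hy)
    convert this using 1; abel
  · filter_upwards [h2, h2'] with N k1 k2 p
    rw [val_append, k1, k2]; rfl
  · filter_upwards [h3 n hn, h3' n hn] with N k1 k2
    obtain ⟨x, hx, k1⟩ := k1
    obtain ⟨y, hy, k2⟩ := k2
    refine ⟨x + y, AddSubgroup.add_mem_sup hx hy, fun p => ?_⟩
    have := (k1 p).add (k2 p)
    rw [cw_append]
    convert this using 1; abel

theorem Ap.word (z : List A) : Ap False U K f {a | a ∈ z} (fun _ (_ : I) => z) := by
  refine ⟨fun _ => val f z, cw z, ⊥, fun h hh => ?_, ?_, fun n hn => ?_⟩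
  · rw [AddSubgroup.mem_bot] at hh
    subst hh
    refine ⟨fun _ => wt z, fun _ => wt_cont z, fun _ => by rw [wt_cnt, add_zero],
      fun _ => wt_eval _ _ _, ?_, False.elim⟩
    intro T _ hT g K' hK' p q
    rfl
  · exact Eventually.of_forall fun N p => rfl
  · refine Eventually.of_forall fun N => ⟨0, zero_mem _, fun p => ?_⟩
    simpa using Dv_zero n

def Conv (U : Ultrafilter ℕ) (u : ℕ → I → List A) : Prop :=
  ∀ k n : ℕ, 0 < n → ∀ᶠ N in (U : Filter ℕ), ∀ p q, EE n k (u N p) (u N q)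

def ContOf (U : Ultrafilter ℕ) (D : Set A) (u : ℕ → I → List A) : Prop :=
  ∀ᶠ N in (U : Filter ℕ), ∀ p, ∀ a, a ∈ u N p ↔ a ∈ D

theorem mul_pow_stab {M : Type} [Monoid M] {x y : M} (h : x * y = x) (n : ℕ) : x * y ^ n = x := by
  induction n with
  | zero => simp
  | succ n ih => rw [pow_succ, ← mul_assoc, ih, h]

theorem pow_mul_stab {M : Type} [Monoid M] {x y : M} (h : y * x = x) (n : ℕ) : y ^ n * x = x := by
  induction n with
  | zero => simp
  | succ n ih => rw [pow_succ, mul_assoc, h, ih]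

theorem EE.cwd {n k : ℕ} {u v : List A} (h : EE n k u v) : Dv n (cw u - cw v) :=
  Dv_of_zmod fun i => by
    have := h.zero.2 i
    simpa [cw] using this

open MTerm in
theorem long_case [Finite A] [Finite M] [Finite I] [Nonempty I] (hK : GoodExp K M)
    {D : Set A} (hD : D.Nonempty) {u X1 X2 r T2 T1 : ℕ → I → List A}
    (hu : Conv U u) (hC : ContOf U D u)
    (h : ∀ᶠ N in (U : Filter ℕ), ∀ p, u N p = (X1 N p ++ X2 N p) ++ (r N p ++ (T2 N p ++ T1 N p)))
    (hX1 : Ap False U K f D X1) (hX2 : Ap False U K f D X2)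
    (hT2 : Ap False U K f D T2) (hT1 : Ap False U K f D T1)
    (hX : ∀ᶠ N in (U : Filter ℕ), ∀ p, val f (X1 N p ++ X2 N p) = val f (X1 N p))
    (hT : ∀ᶠ N in (U : Filter ℕ), ∀ p, val f (T2 N p ++ T1 N p) = val f (T1 N p)) :
    Ap True U K f D u := by
  obtain ⟨s1, c1, H1, g1, v1, d1⟩ := hX1
  obtain ⟨s2, c2, H2, g2, v2, d2⟩ := hX2
  obtain ⟨s3, c3, H3, g3, v3, d3⟩ := hT2
  obtain ⟨s4, c4, H4, g4, v4, d4⟩ := hT1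
  have hs12 : ∀ p, s1 p * s2 p = s1 p := by
    obtain ⟨N, ⟨k1, k2⟩, k3⟩ := ((v1.and v2).and hX).exists
    intro p
    rw [← k1, ← k2, ← val_append, k3]
  have hs34 : ∀ p, s3 p * s4 p = s4 p := by
    obtain ⟨N, ⟨k1, k2⟩, k3⟩ := ((v3.and v4).and hT).exists
    intro p
    rw [← k1, ← k2, ← val_append, k3]
  obtain ⟨m, hmd⟩ : ∃ m : ℕ → I → List A, m = fun N p => X2 N p ++ r N p ++ T2 N p := ⟨_, rfl⟩
  have hm : ∀ᶠ N in (U : Filter ℕ), ∀ p, u N p = X1 N p ++ m N p ++ T1 N p := by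
    filter_upwards [h] with N k p
    simp [k, hmd]
  have hab : ∀ p, AbData U K f D 1 (fun N => m N p) := fun p =>
    ab_main U K f D 1 (fun N => m N p) (by
      filter_upwards [hm, hC] with N k1 k2 a ha
      rw [← k2 p, k1 p]; simp [ha])
  choose v' a Λ e1 e2 e3 using hab
  obtain ⟨c0, hc0, hl⟩ := lattice1 U a Λ (fun N p => cw (m N p)) (eventually_all.2 e2) (by
    intro n hn
    filter_upwards [hm, hu 0 n hn, d1 n hn, d4 n hn] with N k1 k2 k3 k4 p q
    obtain ⟨x, hx, k3⟩ := k3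
    obtain ⟨y, hy, k4⟩ := k4
    have h1 := (k2 p q).cwd
    rw [k1 p, k1 q, cw_append, cw_append, cw_append, cw_append] at h1
    have := (h1.sub ((k3 p).sub (k3 q))).sub ((k4 p).sub (k4 q))
    convert this using 1; abel)
  refine ⟨fun p => s1 p * v' p * s4 p, c1 + c0 + c4, H1 ⊔ (⨅ p, Λ p) ⊔ H4, ?_, ?_, ?_⟩
  · intro h hh
    obtain ⟨h', hh', h4, hh4, rfl⟩ := AddSubgroup.mem_sup.1 hh
    obtain ⟨h1, hh1, hl, hhl, rfl⟩ := AddSubgroup.mem_sup.1 hh'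
    obtain ⟨w1, a1, b1, f1, V1', -⟩ := g1 h1 hh1
    obtain ⟨w2, a2, b2, f2, V2', -⟩ := g2 0 (zero_mem _)
    obtain ⟨w3, a3, b3, f3, V3', -⟩ := g3 0 (zero_mem _)
    obtain ⟨w4, a4, b4, f4, V4', -⟩ := g4 h4 hh4
    have hms : ∀ p, KS K f D 1 (v' p) (c0 + hl) := fun p => by
      have h1 : c0 - a p + hl ∈ Λ p := add_mem (hc0 p) ((AddSubgroup.mem_iInf.1 hhl) p)
      have := e3 p _ h1
      convert this using 1; abel
    choose w am fm bm using hms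
    refine ⟨fun p => mul (w1 p) (mul (mul (mul (om (w2 p)) (w p)) (om (w3 p))) (w4 p)),
      ?_, ?_, ?_, ?_, ?_⟩
    · intro p
      simp only [cont, cont_om, a1, a2, a3, a4]
      have := am p
      ext x
      have := @this x
      simp only [Set.mem_union]
      tauto
    · intro p
      simp only [cnt, cnt_om, b1, b4, bm]
      abel
    · intro p
      simp only [eval, eval_om hK, f1, f2, f3, f4]
      have := fm p
      rw [one_mul] at this
      rw [this]
      simp only [mul_assoc]
      rw [pow_mul_stab (hs34 p), ← mul_assoc, mul_pow_stab (hs12 p)]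
    · intro T _ hT g K' hK' p q
      simp only [eval, eval_om hK']
      rw [V1' T hT g K' hK' p q, V2' T hT g K' hK' p q, V3' T hT g K' hK' p q,
        V4' T hT g K' hK' p q]
      have := V1 hT hK' g (w2 q) (w3 q) (w p) (w q) (by rw [a2]; exact hD) (by rw [a2, a3])
        (by rw [a2]; exact am p) (by rw [a2]; exact am q) (by rw [bm, bm])
      simp only at this
      rw [this]
    · intro _ h0 T _ hT g K' hK' p
      have hc : (w p).cnt = (mul (w p) (mul (om (w3 p)) (mul (w4 p) (mul (w1 p)
          (mul (om (w2 p)) (w p)))))).cnt := by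
        simp only [cnt, cnt_om, b1, b4, bm]
        have : c0 + hl + (c4 + h4) + (c1 + h1) = 0 := by rw [← h0]; abel
        calc c0 + hl = c0 + hl + 0 := by abel
          _ = c0 + hl + (c0 + hl + (c4 + h4) + (c1 + h1)) := by rw [this]
          _ = _ := by abel
      have := V1 hT hK' g (w2 p) (w3 p) (w p) _ (by rw [a2]; exact hD) (by rw [a2, a3])
        (by rw [a2]; exact am p) (by
          simp only [cont, cont_om, a1, a2, a3, a4]
          have := am p
          intro x
          have := @this x
          simp only [Set.mem_union]
          tauto) hc
      simp only [eval, eval_om hK'] at this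
      unfold IsIdempotentElem
      simp only [eval, eval_om hK']
      conv_rhs => rw [this]
      simp only [mul_assoc]
  · filter_upwards [hm, v1, v4, eventually_all.2 e1] with N k1 k2 k3 k4 p
    rw [k1, val_append, val_append, k2, k3, ← k4, one_mul]
  · intro n hn
    filter_upwards [hm, d1 n hn, d4 n hn, hl n hn] with N k1 k2 k3 k4
    obtain ⟨x, hx, k2⟩ := k2
    obtain ⟨y, hy, k3⟩ := k3
    obtain ⟨z, hz, k4⟩ := k4
    refine ⟨x + z + y, AddSubgroup.add_mem_sup (AddSubgroup.add_mem_sup hx hz) hy, fun p => ?_⟩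
    rw [k1, cw_append, cw_append]
    have := ((k2 p).add (k4 p)).add (k3 p)
    convert this using 1; abel

end core


open Filter

section core2
variable {A I M : Type} [Monoid M] {U : Ultrafilter ℕ} {K : ℕ} {f : A → M}

theorem mem_of_preL {a b : A} {u : List A} (h : b ∈ preL a u) : b ∈ u := by
  unfold preL at h
  exact (List.takeWhile_sublist _).subset h

theorem last_letter (u : List A) (hu : u ≠ []) :
    ∃ a ∈ u, ∀ b, b ∈ preL a u ↔ (b ∈ u ∧ b ≠ a) := by
  induction u using List.reverseRecOn with
  | nil => exact absurd rfl hu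
  | append_singleton v x ih =>
    by_cases hx : x ∈ v
    · obtain ⟨a, ha, h⟩ := ih (List.ne_nil_of_mem hx)
      refine ⟨a, by simp [ha], fun b => ?_⟩
      rw [preL_append_of_mem ha, h]
      have : b ∈ v ++ [x] ↔ b ∈ v := by
        simp only [List.mem_append, List.mem_singleton]
        constructor
        · rintro (h | rfl)
          · exact h
          · exact hx
        · exact Or.inl
      rw [this]
    · refine ⟨x, by simp, fun b => ?_⟩
      have h0 : preL x [x] = [] := by simp [preL]
      rw [preL_append_of_not_mem hx, h0]
      simp only [List.append_nil, List.mem_append, List.mem_singleton]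
      constructor
      · intro h
        exact ⟨Or.inl h, fun e => hx (e ▸ h)⟩
      · rintro ⟨h | h, h'⟩
        · exact h
        · exact absurd h h'

theorem Conv.reverse {u : ℕ → I → List A} (h : Conv U u) :
    Conv U (fun N p => (u N p).reverse) := fun k n hn => by
  filter_upwards [h k n hn] with N h p q
  exact (h p q).reverse

theorem Conv.preL {u : ℕ → I → List A} (h : Conv U u) (a : A) :
    Conv U (fun N p => preL a (u N p)) := fun k n hn => by
  filter_upwards [h (k + 1) n hn] with N h p q
  exact ((h p q).2 a).1

theorem Conv.postL {u : ℕ → I → List A} (h : Conv U u) (a : A) :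
    Conv U (fun N p => postL a (u N p)) := fun k n hn => by
  filter_upwards [h (k + 1) n hn] with N h p q
  exact ((h p q).2 a).2.1

theorem Conv.cont [Finite A] [Nonempty I] {u : ℕ → I → List A} (h : Conv U u) :
    ∃ D, ContOf U D u := by
  have p0 : I := Classical.arbitrary I
  obtain ⟨D, hD⟩ := ultra_const U (fun N => {a | a ∈ u N p0})
  refine ⟨D, ?_⟩
  filter_upwards [hD, h 0 1 one_pos] with N h1 h2 p a
  rw [(h2 p p0).1 a, ← h1]; rfl

theorem ContOf.sub {D D' : Set A} {u u' : ℕ → I → List A} [Nonempty I] (h : ContOf U D u)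
    (h' : ContOf U D' u') (hs : ∀ᶠ N in (U : Filter ℕ), ∀ p, ∀ a ∈ u' N p, a ∈ u N p) : D' ⊆ D := by
  obtain ⟨N, ⟨h1, h2⟩, h3⟩ := ((h.and h').and hs).exists
  intro a ha
  have p0 : I := Classical.arbitrary I
  exact (h1 p0 a).1 (h3 p0 a ((h2 p0 a).2 ha))

theorem ContOf.reverse {D : Set A} {u : ℕ → I → List A} (h : ContOf U D u) :
    ContOf U D (fun N p => (u N p).reverse) := by
  filter_upwards [h] with N h p a
  simpa using h p a

theorem lastL [Finite A] [Nonempty I] {u : ℕ → I → List A} {D : Set A} (h : Conv U u)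
    (hC : ContOf U D u) (hD : D.Nonempty) :
    ∃ a ∈ D, ContOf U (D \ {a}) (fun N p => preL a (u N p)) := by
  have p0 : I := Classical.arbitrary I
  obtain ⟨x0, hx0⟩ := hD
  have : ∀ N, ∃ a, u N p0 ≠ [] → (a ∈ u N p0 ∧ ∀ b, b ∈ _root_.preL a (u N p0) ↔
      (b ∈ u N p0 ∧ b ≠ a)) := fun N => by
    by_cases hN : u N p0 = []
    · exact ⟨x0, fun h => absurd hN h⟩
    · obtain ⟨a, h1, h2⟩ := last_letter _ hN
      exact ⟨a, fun _ => ⟨h1, h2⟩⟩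
  choose a ha using this
  obtain ⟨a0, ha0⟩ := ultra_const U a
  have key : ∀ᶠ N in (U : Filter ℕ), a0 ∈ u N p0 ∧ ∀ b, b ∈ _root_.preL a0 (u N p0) ↔
      (b ∈ u N p0 ∧ b ≠ a0) := by
    filter_upwards [ha0, hC] with N h1 h2
    rw [← h1]
    exact ha N (List.ne_nil_of_mem ((h2 p0 x0).2 hx0))
  refine ⟨a0, ?_, ?_⟩
  · obtain ⟨N, h1, h2⟩ := (key.and hC).exists
    exact (h2 p0 a0).1 h1.1
  · filter_upwards [key, hC, h.preL a0 0 1 one_pos] with N h1 h2 h3 p b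
    rw [(h3 p p0).1 b, h1.2 b, h2 p0 b]; rfl

theorem diff_union {D : Set A} {a : A} (ha : a ∈ D) : (D \ {a}) ∪ {b | b ∈ [a]} = D := by
  ext b
  simp only [Set.mem_union, Set.mem_sdiff, Set.mem_singleton_iff, Set.mem_ofPred_eq,
    List.mem_singleton]
  by_cases h : b = a
  · simp [h, ha]
  · simp [h]

theorem diff_ssub {D : Set A} {a : A} (ha : a ∈ D) : D \ {a} ⊂ D :=
  ⟨Set.sdiff_subset, fun h => (h ha).2 rfl⟩

theorem stepL [Finite A] [Nonempty I] {u : ℕ → I → List A} {D : Set A}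
    (IH : ∀ D' ⊂ D, ∀ v : ℕ → I → List A, Conv U v → ContOf U D' v → Ap False U K f D' v)
    (h : Conv U u) (hC : ContOf U D u) (hD : D.Nonempty) :
    ∃ a ∈ D, Ap False U K f D (fun N p => preL a (u N p) ++ [a]) ∧
      ∀ᶠ N in (U : Filter ℕ), ∀ p, u N p = (preL a (u N p) ++ [a]) ++ postL a (u N p) := by
  obtain ⟨a, ha, hc⟩ := lastL h hC hD
  refine ⟨a, ha, ?_, ?_⟩
  · have := (IH _ (diff_ssub ha) _ (h.preL a) hc).mul (Ap.word [a])
    rwa [diff_union ha] at this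
  · filter_upwards [hC] with N h p
    exact preL_post ((h p a).2 ha)

theorem stepR [Finite A] [Nonempty I] {u : ℕ → I → List A} {D : Set A}
    (IH : ∀ D' ⊂ D, ∀ v : ℕ → I → List A, Conv U v → ContOf U D' v → Ap False U K f D' v)
    (h : Conv U u) (hC : ContOf U D u) (hD : D.Nonempty) :
    ∃ a ∈ D, Ap False U K f D (fun N p => [a] ++ (preL a (u N p).reverse).reverse) ∧
      ∀ᶠ N in (U : Filter ℕ), ∀ p, u N p = (postL a (u N p).reverse).reverse ++
        ([a] ++ (preL a (u N p).reverse).reverse) := by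
  obtain ⟨a, ha, hc⟩ := lastL h.reverse hC.reverse hD
  refine ⟨a, ha, ?_, ?_⟩
  · have := (Ap.word [a]).mul (IH _ (diff_ssub ha) _ (h.reverse.preL a).reverse hc.reverse)
    rwa [Set.union_comm, diff_union ha] at this
  · filter_upwards [hC] with N h p
    have := congrArg List.reverse (preL_post (a := a) (u := (u N p).reverse) (by
      simpa using (h p a).2 ha))
    simpa using this

theorem mem_of_postL {a b : A} {u : List A} (h : b ∈ postL a u) : b ∈ u := by
  unfold postL at h
  exact (List.dropWhile_sublist _).subset (List.mem_of_mem_tail h)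

/-- generic one sided dichotomy -/
theorem dich1 [Finite M] [Finite I] {D : Set A} (cat : List A → List A → List A)
    (hassoc : ∀ x y z, cat (cat x y) z = cat x (cat y z)) (hnil : ∀ x, cat [] x = x)
    (hnil' : ∀ x, cat x [] = x)
    (hApc : ∀ D' ⊆ D, ∀ x y : ℕ → I → List A, Ap False U K f D x → Ap False U K f D' y →
      Ap False U K f D (fun N p => cat (x N p) (y N p)))
    (Q : (ℕ → I → List A) → Prop)
    (hstep : ∀ r, Conv U r → ContOf U D r → Q r → ∃ b r' : ℕ → I → List A,
      (∀ᶠ N in (U : Filter ℕ), ∀ p, r N p = cat (b N p) (r' N p)) ∧ Ap False U K f D b ∧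
      Conv U r' ∧ Q r' ∧ ∃ D' ⊆ D, ContOf U D' r')
    (u : ℕ → I → List A) (hu : Conv U u) (hC : ContOf U D u) (hQ : Q u) :
    (∃ (r : ℕ → I → List A) (D' : Set A), D' ⊂ D ∧ Q r ∧ Conv U r ∧ ContOf U D' r ∧
      (Ap False U K f D' r → Ap False U K f D u)) ∨
    (∃ X1 X2 r : ℕ → I → List A,
      (∀ᶠ N in (U : Filter ℕ), ∀ p, u N p = cat (cat (X1 N p) (X2 N p)) (r N p)) ∧
      Ap False U K f D X1 ∧ Ap False U K f D X2 ∧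
      (∀ᶠ N in (U : Filter ℕ), ∀ p, val f (cat (X1 N p) (X2 N p)) = val f (X1 N p)) ∧
      Conv U r ∧ ContOf U D r ∧ Q r ∧ (Ap False U K f D r → Ap False U K f D u)) := by
  suffices H : ∀ (V : Set (I → M)) (X r : ℕ → I → List A),
      (∀ᶠ N in (U : Filter ℕ), ∀ p, u N p = cat (X N p) (r N p)) → Conv U r → ContOf U D r → Q r →
      (∀ b, Ap False U K f D b → Ap False U K f D (fun N p => cat (X N p) (b N p))) →
      (∀ v ∈ V, ∃ X1 Y : ℕ → I → List A, (∀ᶠ N in (U : Filter ℕ), ∀ p, X N p = cat (X1 N p) (Y N p)) ∧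
        Ap False U K f D X1 ∧ (∀ᶠ N in (U : Filter ℕ), ∀ p, val f (X1 N p) = v p) ∧
        ∀ b, Ap False U K f D b → Ap False U K f D (fun N p => cat (Y N p) (b N p))) → _ from
    H ∅ (fun _ _ => []) u (Eventually.of_forall fun N p => by rw [hnil]) hu hC hQ
      (fun b hb => by simpa only [hnil] using hb) (fun v hv => absurd hv (Set.notMem_empty v))
  intro V
  induction V using WellFoundedGT.induction with
  | ind V ih =>
  intro X r hur hr hCr hQr hX hV
  obtain ⟨b, r', hb1, hb2, hr', hQr', D', hD', hCr'⟩ := hstep r hr hCr hQr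
  have hXb := hX b hb2
  have hu' : ∀ᶠ N in (U : Filter ℕ), ∀ p, u N p = cat (cat (X N p) (b N p)) (r' N p) := by
    filter_upwards [hur, hb1] with N k1 k2 p
    rw [k1, k2, hassoc]
  have hfin : Ap False U K f D' r' → Ap False U K f D u := fun h =>
    (hApc D' hD' _ _ hXb h).congr hu'
  by_cases hne : D' = D
  swap
  · exact Or.inl ⟨r', D', lt_of_le_of_ne hD' hne, hQr', hr', hCr', hfin⟩
  subst hne
  obtain ⟨s', c', H', q1, hs', q3⟩ := id hXb
  by_cases hs : s' ∈ V
  · right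
    obtain ⟨X1, Y, k1, k2, k3, k4⟩ := hV s' hs
    refine ⟨X1, fun N p => cat (Y N p) (b N p), r', ?_, k2, k4 b hb2, ?_, hr', hCr', hQr', hfin⟩
    · filter_upwards [hu', k1] with N j1 j2 p
      simp only [j1, j2, hassoc]
    · filter_upwards [hs', k1, k3] with N j1 j2 j3 p
      rw [← hassoc, ← j2, j1, j3]
  · refine ih (insert s' V) ⟨Set.subset_insert _ _, fun h => hs (h (Set.mem_insert _ _))⟩
      (fun N p => cat (X N p) (b N p)) r' hu' hr' hCr' hQr' (fun b' hb' =>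
        hApc _ le_rfl _ _ hXb hb') ?_
    intro v hv
    rcases hv with rfl | hv
    · refine ⟨fun N p => cat (X N p) (b N p), fun _ _ => [], ?_, hXb, hs', fun b' hb' => by
        simpa only [hnil] using hb'⟩
      exact Eventually.of_forall fun N p => (hnil' _).symm
    · obtain ⟨X1, Y, k1, k2, k3, k4⟩ := hV v hv
      refine ⟨X1, fun N p => cat (Y N p) (b N p), ?_, k2, k3, fun b' hb' =>
        hApc _ le_rfl _ _ (k4 b hb2) hb'⟩
      filter_upwards [k1] with N j p
      rw [j, hassoc]

theorem dich [Finite A] [Finite M] [Finite I] [Nonempty I] (hK : GoodExp K M) {D : Set A}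
    (hD : D.Nonempty)
    (IH : ∀ D' ⊂ D, ∀ v : ℕ → I → List A, Conv U v → ContOf U D' v → Ap False U K f D' v)
    (Q : (ℕ → I → List A) → Prop)
    (hQL : ∀ r, Q r → ∀ a ∈ D, Q (fun N p => postL a (r N p)))
    (hQR : ∀ r, Q r → ∀ a ∈ D, Q (fun N p => (postL a (r N p).reverse).reverse))
    (u : ℕ → I → List A) (hu : Conv U u) (hC : ContOf U D u) (hQ : Q u) :
    (∃ (r : ℕ → I → List A) (D' : Set A), D' ⊂ D ∧ Q r ∧ Conv U r ∧ ContOf U D' r ∧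
      (Ap False U K f D' r → Ap False U K f D u)) ∨ Ap True U K f D u := by
  rcases dich1 (U := U) (K := K) (f := f) (D := D) (fun x y => x ++ y) (fun x y z => List.append_assoc x y z)
    (fun x => rfl) List.append_nil
    (fun D' hD' x y hx hy => by
      have := hx.mul hy
      rwa [Set.union_eq_self_of_subset_right hD'] at this) Q
    (fun r hr hCr hQr => by
      obtain ⟨a, ha, h1, h2⟩ := stepL IH hr hCr hD
      obtain ⟨D', hD'⟩ := (hr.postL a).cont
      exact ⟨_, _, h2, h1, hr.postL a, hQL r hQr a ha, D', hCr.sub hD' (Eventually.of_forall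
        fun N p b hb => mem_of_postL hb), hD'⟩) u hu hC hQ with h | h
  · exact Or.inl h
  obtain ⟨X1, X2, r, h1, h2, h3, h4, h5, h6, h7, h8⟩ := h
  rcases dich1 (U := U) (K := K) (f := f) (D := D) (fun x y => y ++ x)
    (fun x y z => (List.append_assoc z y x).symm)
    (fun x => List.append_nil x) (fun x => rfl)
    (fun D' hD' x y hx hy => by
      have := hy.mul hx
      rwa [Set.union_eq_self_of_subset_left hD'] at this) Q
    (fun r hr hCr hQr => by
      obtain ⟨a, ha, h1, h2⟩ := stepR IH hr hCr hD
      obtain ⟨D', hD'⟩ := (hr.reverse.postL a).reverse.cont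
      exact ⟨_, _, h2, h1, (hr.reverse.postL a).reverse, hQR r hQr a ha, D',
        hCr.sub hD' (Eventually.of_forall
        fun N p b hb => by simpa using mem_of_postL (List.mem_reverse.1 hb)), hD'⟩) r h5 h6 h7 with h | h
  · obtain ⟨r', D', k1, k2, k3, k4, k5⟩ := h
    exact Or.inl ⟨r', D', k1, k2, k3, k4, fun h => h8 (k5 h)⟩
  · obtain ⟨T1, T2, r', k1, k2, k3, k4, -⟩ := h
    right
    refine long_case hK hD (r := r') hu hC ?_ h2 h3 k3 k2 h4 k4
    filter_upwards [h1, k1] with N j1 j2 p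
    rw [j1, j2]

theorem main_ap [Finite A] [Finite M] [Finite I] [Nonempty I] (hK : GoodExp K M) (D : Set A) :
    ∀ u : ℕ → I → List A, Conv U u → ContOf U D u → Ap False U K f D u := by
  induction D using WellFoundedLT.induction with
  | ind D IH =>
  intro u hu hC
  rcases Set.eq_empty_or_nonempty D with rfl | hD
  · have := Ap.word (I := I) (U := U) (K := K) (f := f) []
    have h2 : {a : A | a ∈ ([] : List A)} = ∅ := by ext; simp
    rw [h2] at this
    refine this.congr ?_
    filter_upwards [hC] with N h p
    exact List.eq_nil_iff_forall_not_mem.2 fun a ha => (h p a).1 ha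
  · rcases dich hK hD IH (fun _ => True) (fun _ _ _ _ => trivial) (fun _ _ _ _ => trivial) u hu hC
      trivial with ⟨r, D', h1, -, h3, h4, h5⟩ | h
    · exact h5 (IH D' h1 r h3 h4)
    · exact h.weaken

end core2


open Filter

section fin
variable {A I M : Type} [Monoid M] {U : Ultrafilter ℕ} {K : ℕ} {f : A → M}

theorem final_good [Finite A] [Finite M] [Finite I] [Nonempty I] (hK : GoodExp K M)
    (u : ℕ → I → List A) (hu : Conv U u)
    (hid : ∀ k n : ℕ, 0 < n → ∀ᶠ N in (U : Filter ℕ), ∀ p, EE n k (u N p) (u N p ++ u N p))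
    (s : I → M) (hs : ∀ N p, val f (u N p) = s p) (hne : ∀ N p, u N p ≠ []) :
    ∃ D : Set A, D.Nonempty ∧ Good True K f D s 0 := by
  have p0 : I := Classical.arbitrary I
  obtain ⟨D, hD⟩ := hu.cont
  have hDn : D.Nonempty := by
    obtain ⟨N, h⟩ := hD.exists
    obtain ⟨a, ha⟩ := List.exists_mem_of_ne_nil _ (hne N p0)
    exact ⟨a, (h p0 a).1 ha⟩
  refine ⟨D, hDn, ?_⟩
  let Q : (ℕ → I → List A) → Prop := fun r => ∃ y y' : ℕ → List A, ∀ k n : ℕ, 0 < n →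
    ∀ᶠ N in (U : Filter ℕ), EE n k (r N p0) (y N ++ u N p0 ++ y' N)
  have hQ2 : ∀ (r : ℕ → I → List A) (y y' : ℕ → List A), (∀ k n : ℕ, 0 < n →
      ∀ᶠ N in (U : Filter ℕ), EE n k (r N p0) (y N ++ u N p0 ++ y' N)) → ∀ k n : ℕ, 0 < n →
      ∀ᶠ N in (U : Filter ℕ), EE n k (r N p0) ((y N ++ u N p0) ++ (u N p0 ++ y' N)) := by
    intro r y y' h k n hn
    filter_upwards [h k n hn, hid k n hn] with N h1 h2
    refine h1.trans ?_
    have := ((EE.refl k (y N)).append (h2 p0)).append (EE.refl k (y' N))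
    simpa using this
  have hd := dich (U := U) (f := f) hK hDn (fun D' _ => main_ap hK D') Q
    (by
      rintro r ⟨y, y', h⟩ a ha
      refine ⟨fun N => postL a (y N ++ u N p0), y', fun k n hn => ?_⟩
      filter_upwards [hQ2 r y y' h (k + 1) n hn, hD] with N h1 h2
      have h3 := (h1.2 a).2.1
      rw [postL_append_of_mem (by simp [(h2 p0 a).2 ha])] at h3
      simpa using h3)
    (by
      rintro r ⟨y, y', h⟩ a ha
      refine ⟨y, fun N => (postL a (u N p0 ++ y' N).reverse).reverse, fun k n hn => ?_⟩
      filter_upwards [hQ2 r y y' h (k + 1) n hn, hD] with N h1 h2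
      have h3 := (h1.2 a).2.2.2
      rw [List.reverse_append, postL_append_of_mem (by simp [(h2 p0 a).2 ha])] at h3
      have := h3.reverse
      rw [List.reverse_append, List.reverse_reverse] at this
      exact this)
    u hu hD ⟨fun _ => [], fun _ => [], fun k n hn => Eventually.of_forall fun N => by
      simpa using EE.refl k (u N p0)⟩
  rcases hd with ⟨r, D', h1, ⟨y, y', h2⟩, -, h4, -⟩ | hd
  · exfalso
    apply h1.2
    obtain ⟨N, ⟨k1, k2⟩, k3⟩ := ((h4.and hD).and (h2 0 1 one_pos)).exists
    intro a ha
    exact (k1 p0 a).1 ((k3.1 a).2 (by simp [(k2 p0 a).2 ha]))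
  · obtain ⟨s', c, H, g, hv, hc⟩ := hd
    have hss : s' = s := by
      obtain ⟨N, h⟩ := hv.exists
      ext p
      rw [← h, hs]
    subst hss
    have hm : -c ∈ H := closed_sub H (-c) fun n hn => by
      obtain ⟨N, ⟨h, hh, h1⟩, h2⟩ := ((hc n hn).and (hid 0 n hn)).exists
      refine ⟨h, hh, ?_⟩
      have := (h2 p0).cwd
      rw [cw_append] at this
      have := this.add (h1 p0)
      convert this using 1; abel
    have := g _ hm
    rwa [add_neg_cancel] at this

theorem coe_spow {T : Type} [Semigroup T] (s : T) (n : ℕ) :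
    ((spow s n : T) : WithOne T) = (s : WithOne T) ^ (n + 1) := by
  induction n with
  | zero => simp [spow]
  | succ n ih =>
    rw [pow_succ, ← ih]
    unfold spow
    rw [Function.iterate_succ_apply']
    rfl

def MTerm.strip : MTerm A → Option (KTerm A)
  | one => none
  | letter a => some (KTerm.letter a)
  | mul u v =>
    match strip u, strip v with
    | none, y => y
    | some x, none => some x
    | some x, some y => some (KTerm.mul x y)
  | pow u => (strip u).map KTerm.ommPow

theorem strip_spec {T : Type} [Semigroup T] (hK : GoodExp K (WithOne T)) (g : A → T)
    (m : MTerm A) : (m.strip = none → m.eval K (fun a => (g a : WithOne T)) = 1) ∧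
      ∀ k, m.strip = some k → ∃ t : T, m.eval K (fun a => (g a : WithOne T)) = t ∧ KEval g k t := by
  induction m with
  | one => exact ⟨fun _ => rfl, fun k hk => by simp [MTerm.strip] at hk⟩
  | letter a =>
    refine ⟨fun h => by simp [MTerm.strip] at h, fun k hk => ?_⟩
    simp only [MTerm.strip, Option.some.injEq] at hk
    subst hk
    exact ⟨g a, rfl, KEval.letter a⟩
  | mul u v ihu ihv =>
    simp only [MTerm.strip, MTerm.eval]
    cases hu : u.strip with
    | none =>
      rw [ihu.1 hu, one_mul]
      exact ihv
    | some x =>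
      obtain ⟨s, hs1, hs2⟩ := ihu.2 x hu
      cases hv : v.strip with
      | none =>
        rw [ihv.1 hv, mul_one]
        refine ⟨fun h => by simp at h, fun k hk => ?_⟩
        obtain rfl : x = k := by simpa using hk
        exact ⟨s, hs1, hs2⟩
      | some y =>
        obtain ⟨t, ht1, ht2⟩ := ihv.2 y hv
        refine ⟨fun h => by simp at h, fun k hk => ?_⟩
        obtain rfl : KTerm.mul x y = k := by simpa using hk
        exact ⟨s * t, by rw [hs1, ht1]; rfl, KEval.mul hs2 ht2⟩
  | pow u ih =>
    simp only [MTerm.strip, MTerm.eval]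
    cases hu : u.strip with
    | none =>
      rw [ih.1 hu, one_pow]
      exact ⟨fun _ => rfl, fun k hk => by simp at hk⟩
    | some x =>
      obtain ⟨s, hs1, hs2⟩ := ih.2 x hu
      refine ⟨fun h => by simp at h, fun k hk => ?_⟩
      obtain rfl : KTerm.ommPow x = k := by simpa using hk
      have hp := hK.pos
      have e1 : ((spow s (2 * K - 2) : T) : WithOne T) = (s : WithOne T) ^ (2 * K - 1) := by
        rw [coe_spow]; congr 1; omega
      have e2 : ((spow s (K - 1) : T) : WithOne T) = (s : WithOne T) ^ K := by
        rw [coe_spow]; congr 1; omega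
      have hi := hK.idem (s : WithOne T)
      have h2 := hK.two_mul (s : WithOne T)
      refine ⟨spow s (2 * K - 2), by rw [hs1, e1],
        KEval.ommPow (e := spow s (K - 1)) hs2 ?_ ⟨_, rfl⟩ ⟨_, rfl⟩ ?_ ?_ ?_⟩
      · rw [← e2] at hi
        unfold IsIdempotentElem at hi ⊢
        exact_mod_cast hi
      · rw [← e1, ← e2] at h2
        exact_mod_cast h2
      · rw [← pow_succ, pow_succ', ← e1, ← e2] at h2
        exact_mod_cast h2
      · have : (s : WithOne T) ^ (2 * K - 1) * (s : WithOne T) ^ K = (s : WithOne T) ^ (2 * K - 1) := by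
          have e : (s : WithOne T) ^ (2 * K - 1) = (s : WithOne T) ^ (K - 1) * (s : WithOne T) ^ K := by
            rw [← pow_add]; congr 1; omega
          rw [e, mul_assoc, hi]
        rw [← e1, ← e2] at this
        exact_mod_cast this

theorem exists_idem_elem (T : Type) [Semigroup T] [Finite T] [Nonempty T] :
    ∃ t : T, IsIdempotentElem t := by
  have : Finite (WithOne T) := inferInstanceAs (Finite (Option T))
  obtain ⟨K, hK⟩ := exists_goodExp (WithOne T)
  obtain ⟨s, hs⟩ := coe_pow_exists (Classical.arbitrary T) hK.pos
  refine ⟨s, ?_⟩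
  have := hK.idem (Classical.arbitrary T : T)
  rw [hs] at this
  unfold IsIdempotentElem at this ⊢
  exact_mod_cast this

def fsl (u : FreeSemigroup A) : List A := u.head :: u.tail

theorem fsl_mul (u v : FreeSemigroup A) : fsl (u * v) = fsl u ++ fsl v := by
  simp [fsl]

theorem fsl_val {S : Type} [Semigroup S] (φ : FreeSemigroup A →ₙ* S) (u : FreeSemigroup A) :
    val (fun a => ((φ (FreeSemigroup.of a) : S) : WithOne S)) (fsl u) = ((φ u : S) : WithOne S) := by
  induction u using FreeSemigroup.recOnMul with
  | ih1 a => simp [fsl, val]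
  | ih2 a v h1 h2 => rw [fsl_mul, val_append, h1, h2, map_mul]; rfl

theorem words_exist {S : Type} [Semigroup S] [Finite A]
    (P : Set S) (hP : IsDOAbIdempotentPointlike P)
    (φ : FreeSemigroup A →ₙ* S) (hφ : Function.Surjective φ) (n k : ℕ) (hn : 0 < n) :
    ∃ u : P → List A, (∀ p : P, val (fun a => ((φ (FreeSemigroup.of a) : S) : WithOne S)) (u p) =
      ((p : S) : WithOne S)) ∧ (∀ p, u p ≠ []) ∧ (∀ p q, EE n k (u p) (u q)) ∧
      ∀ p, EE n k (u p) (u p ++ u p) := by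
  have : NeZero n := ⟨hn.ne'⟩
  have : Finite (EEQ A n k) := EEs_finite k
  let R : Subsemigroup (S × EEQ A n k) :=
    { carrier := {x | ∃ u : FreeSemigroup A, φ u = x.1 ∧ EEQ.mk n k (fsl u) = x.2}
      mul_mem' := by
        rintro ⟨_, _⟩ ⟨_, _⟩ ⟨u, rfl, rfl⟩ ⟨v, rfl, rfl⟩
        exact ⟨u * v, by simp, by rw [fsl_mul, EEQ.mk_append]; rfl⟩ }
  obtain ⟨t, ht, h⟩ := hP (EEQ A n k) (EEQ_inDOAb hn k) R (fun s => by
    obtain ⟨u, rfl⟩ := hφ s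
    exact ⟨_, u, rfl, rfl⟩)
  have h' : ∀ p : P, ∃ u : FreeSemigroup A, φ u = p ∧ EEQ.mk n k (fsl u) = t := fun p => h p p.2
  choose u h1 h2 using h'
  refine ⟨fun p => fsl (u p), fun p => by rw [fsl_val, h1], fun p => by simp [fsl], fun p q => ?_,
    fun p => ?_⟩
  · rw [← EEQ.mk_eq, h2, h2]
  · rw [← EEQ.mk_eq, EEQ.mk_append, h2]; exact ht.symm

end fin

/-- The pseudovariety `DO ∩ Ab̄` is κ-reducible for idempotent pointlike sets. -/
theorem DOAb_kappa_reducible_for_idempotent_pointlikes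
    {S : Type} [Semigroup S] [Finite S]
    (P : Set S) (hP : IsDOAbIdempotentPointlike P)
    (A : Type) [Finite A]
    (φ : FreeSemigroup A →ₙ* S) (hφ : Function.Surjective φ) :
    ∃ w : P → KTerm A,
      (∀ p : P, KEval (fun a => φ (FreeSemigroup.of a)) (w p) (p : S)) ∧
      (∀ (T : Type) [Semigroup T] [Finite T], InDOAb T →
        ∀ f : A → T, ∃ t : T, IsIdempotentElem t ∧ ∀ p : P, KEval f (w p) t) := by
  rcases isEmpty_or_nonempty P with hPe | hPn
  · refine ⟨fun p => isEmptyElim p, fun p => isEmptyElim p, fun T _ _ hT f => ?_⟩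
    rcases isEmpty_or_nonempty A with hA | ⟨⟨a⟩⟩
    · exfalso
      obtain ⟨t, -⟩ := hP (Fin 0 × S) (fun s => s.1.elim0) ⊤ (fun s => by
        obtain ⟨u, -⟩ := hφ s
        exact isEmptyElim u.head)
      exact t.1.elim0
    · have : Nonempty T := ⟨f a⟩
      obtain ⟨t, ht⟩ := exists_idem_elem T
      exact ⟨t, ht, fun p => isEmptyElim p⟩
  · have : Finite (WithOne S) := inferInstanceAs (Finite (Option S))
    obtain ⟨K, hK⟩ := exists_goodExp (WithOne S)
    choose u h1 h2 h3 h4 using fun N : ℕ => words_exist P hP φ hφ (N.factorial) N N.factorial_pos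
    have hev : ∀ k n : ℕ, 0 < n → ∀ᶠ N in (hyperfilter ℕ : Filter ℕ), k ≤ N ∧ n ∣ N.factorial := by
      intro k n hn
      refine Nat.hyperfilter_le_atTop ?_
      filter_upwards [eventually_ge_atTop k, eventually_ge_atTop n] with N g1 g2
      exact ⟨g1, Nat.dvd_factorial hn g2⟩
    obtain ⟨D, hD, w, c1, -, c3, c4, c5⟩ := final_good (U := hyperfilter ℕ) hK u
      (fun k n hn => by
        filter_upwards [hev k n hn] with N g p q
        exact ((h3 N p q).le g.1).dvd g.2)
      (fun k n hn => by
        filter_upwards [hev k n hn] with N g p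
        exact ((h4 N p).le g.1).dvd g.2) (fun p => ((p : S) : WithOne S)) h1 h2
    have hk : ∀ p, ∃ k, (w p).strip = some k := by
      intro p
      cases h : (w p).strip with
      | some k => exact ⟨k, rfl⟩
      | none =>
        have := (strip_spec hK (fun a => φ (FreeSemigroup.of a)) (w p)).1 h
        rw [c3] at this
        exact absurd this WithOne.coe_ne_one
    choose k hk using hk
    refine ⟨k, fun p => ?_, fun T _ _ hT f => ?_⟩
    · obtain ⟨t, ht, h⟩ := (strip_spec hK (fun a => φ (FreeSemigroup.of a)) (w p)).2 _ (hk p)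
      rw [c3] at ht
      rw [WithOne.coe_inj.1 ht]
      exact h
    · have : Finite (WithOne T) := inferInstanceAs (Finite (Option T))
      obtain ⟨K', hK'⟩ := exists_goodExp (WithOne T)
      choose t ht h using fun p => (strip_spec hK' f (w p)).2 _ (hk p)
      have p0 : P := Classical.arbitrary P
      refine ⟨t p0, ?_, fun p => ?_⟩
      · have := c5 trivial rfl T hT f K' hK' p0
        rw [ht] at this
        unfold IsIdempotentElem at this ⊢
        exact_mod_cast this
      · have := c4 T hT f K' hK' p p0
        rw [ht, ht] at this
        rw [← WithOne.coe_inj.1 this]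
        exact h p
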